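/- If a compact set K ⊂ T supports a nonzero distribution S with ∑_{n<0} |Ŝ(n)|²/|n|^{1-a} < ∞ for some 0 < a ≤ 1, then the Hausdorff dimension of K is at least a. -/

import Mathlib

open MeasureTheory Complex Filter

/-- The `n`-th Fourier coefficient of a `2π`-periodic function on `ℝ`. -/
noncomputable def fourierCoeffPeriodic (f : ℝ → ℂ) (n : ℤ) : ℂ :=
  (1 / (2 * Real.pi)) • ∫ t in (0 : ℝ)..(2 * Real.pi),
    Complex.exp (-Complex.I * n * t) * f t

/-- Polynomial growth of a sequence of Fourier coefficients; sequences of polynomial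
growth are exactly the Fourier coefficient sequences of Schwartz distributions `S = ∑ aₙ
e^{int}` on the circle `ℝ/2πℤ`. -/
def HasPolyGrowth (a : ℤ → ℂ) : Prop :=
  ∃ C k : ℝ, ∀ n : ℤ, ‖a n‖ ≤ C * (1 + |(n : ℝ)|) ^ k

/-- The distribution `S = ∑ aₙ e^{int}` on the circle `ℝ/2πℤ` is supported in `K`:
`⟨S, f⟩ = ∑ aₙ f̂(-n) = 0` for every smooth `2π`-periodic test function `f` vanishing
on a neighborhood of (the periodization of) `K`. -/
def DistribSupportedIn (a : ℤ → ℂ) (K : Set ℝ) : Prop :=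
  ∀ f : ℝ → ℂ, ContDiff ℝ (⊤ : ℕ∞) f → Function.Periodic f (2 * Real.pi) →
    (∃ U : Set ℝ, IsOpen U ∧ (⋃ m : ℤ, (fun t => t + 2 * Real.pi * m) '' K) ⊆ U ∧
      ∀ t ∈ U, f t = 0) →
    ∑' n : ℤ, a n * fourierCoeffPeriodic f (-n) = 0

/-- The character `t ↦ e^{int}` of the circle `ℝ/2πℤ`. -/
noncomputable def circleChar (n : ℤ) (t : ℝ) : ℂ := Complex.exp (Complex.I * n * t)

lemma continuous_circleChar (n : ℤ) : Continuous (circleChar n) := by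
  unfold circleChar; fun_prop

@[simp] lemma norm_circleChar (n : ℤ) (t : ℝ) : ‖circleChar n t‖ = 1 := by
  simp [circleChar, Complex.norm_exp]

lemma circleChar_add (m n : ℤ) (t : ℝ) :
    circleChar (m + n) t = circleChar m t * circleChar n t := by
  simp only [circleChar, ← Complex.exp_add]; push_cast; ring_nf

@[simp] lemma circleChar_zero (t : ℝ) : circleChar 0 t = 1 := by simp [circleChar]

lemma conj_circleChar (n : ℤ) (t : ℝ) :
    (starRingEnd ℂ) (circleChar n t) = circleChar (-n) t := by
  simp [circleChar, ← Complex.exp_conj]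

lemma circleChar_periodic (n : ℤ) : Function.Periodic (circleChar n) (2 * Real.pi) := by
  intro t
  simp only [circleChar]
  rw [Complex.exp_eq_exp_iff_exists_int]
  exact ⟨n, by push_cast; ring⟩

lemma integral_circleChar (x : ℝ) (n : ℤ) :
    ∫ t in x..(x + 2 * Real.pi), circleChar n t = if n = 0 then (2 * Real.pi : ℂ) else 0 := by
  split_ifs with h
  · subst h; simp
  · have h2 : Complex.I * n ≠ 0 := by simp [h]
    unfold circleChar
    rw [integral_exp_mul_complex h2]
    have := circleChar_periodic n x
    unfold circleChar at this
    rw [this]; simp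

/-- Termwise integration of an absolutely convergent trigonometric series against a
continuous function. -/
lemma hasSum_mul_integral_circleChar {ι : Type*} [Countable ι] {c : ι → ℂ}
    (hc : Summable fun i => ‖c i‖) (ν : ι → ℤ) {g : ℝ → ℂ} (hg : Continuous g) (u v : ℝ) :
    HasSum (fun i => c i * ∫ t in u..v, circleChar (ν i) t * g t)
      (∫ t in u..v, (∑' i, c i * circleChar (ν i) t) * g t) := by
  have key := intervalIntegral.hasSum_integral_of_dominated_convergence
    (μ := volume) (a := u) (b := v)
    (F := fun i t => c i * (circleChar (ν i) t * g t))
    (f := fun t => (∑' i, c i * circleChar (ν i) t) * g t)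
    (fun i t => ‖c i‖ * ‖g t‖) ?_ ?_ ?_ ?_ ?_
  · simpa [intervalIntegral.integral_const_mul] using key
  · intro i
    exact (continuous_const.mul ((continuous_circleChar _).mul hg)).aestronglyMeasurable
  · intro i
    exact Eventually.of_forall fun t _ => by simp
  · exact Eventually.of_forall fun t _ => hc.mul_right _
  · have : (fun t => ∑' i, ‖c i‖ * ‖g t‖) = fun t => (∑' i, ‖c i‖) * ‖g t‖ := by
      ext t; rw [tsum_mul_right]
    rw [this]
    exact (continuous_const.mul hg.norm).intervalIntegrable _ _
  · refine Eventually.of_forall fun t _ => ?_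
    have hs : Summable fun i => c i * circleChar (ν i) t :=
      Summable.of_norm (by simpa using hc)
    simpa [mul_assoc] using hs.hasSum.mul_right (g t)

lemma continuous_tsum_circleChar {ι : Type*} {c : ι → ℂ}
    (hc : Summable fun i => ‖c i‖) (ν : ι → ℤ) :
    Continuous fun t => ∑' i, c i * circleChar (ν i) t :=
  continuous_tsum (fun i => continuous_const.mul (continuous_circleChar _)) hc
    (fun i t => by simp)

/-- The Fourier coefficients of an absolutely convergent trigonometric power series. -/
lemma integral_circleChar_mul_tsum {c : ℕ → ℂ} (hc : Summable fun i => ‖c i‖) (x : ℝ) (n : ℤ) :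
    ∫ t in x..(x + 2 * Real.pi), circleChar n t * ∑' i : ℕ, c i * circleChar i t =
      if n ≤ 0 then 2 * Real.pi * c (-n).toNat else 0 := by
  have h := hasSum_mul_integral_circleChar hc (fun i : ℕ => (i : ℤ)) (continuous_circleChar n)
    x (x + 2 * Real.pi)
  have h2 : ∀ i : ℕ, ∫ t in x..(x + 2 * Real.pi), circleChar i t * circleChar n t =
      if (i : ℤ) + n = 0 then (2 * Real.pi : ℂ) else 0 := by
    intro i
    simp_rw [← circleChar_add]
    exact integral_circleChar x _
  simp_rw [h2] at h
  have h3 : ∫ t in x..(x + 2 * Real.pi), circleChar n t * ∑' i : ℕ, c i * circleChar i t =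
      ∫ t in x..(x + 2 * Real.pi), (∑' i : ℕ, c i * circleChar i t) * circleChar n t := by
    simp_rw [mul_comm]
  rw [h3]
  refine h.unique ?_
  split_ifs with hn
  · convert hasSum_ite_eq (-n).toNat (2 * Real.pi * c (-n).toNat) using 2 with i
    by_cases hi : i = (-n).toNat
    · subst hi
      rw [if_pos (by omega), if_pos rfl]; ring
    · rw [if_neg (by omega), if_neg hi]; simp
  · convert hasSum_zero using 2 with i
    rw [if_neg (by omega)]; simp

/-- Parseval's identity for an absolutely convergent trigonometric power series. -/
lemma hasSum_sq_norm_integral {c : ℕ → ℂ} (hc : Summable fun i => ‖c i‖) (x : ℝ) :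
    HasSum (fun i => 2 * Real.pi * ‖c i‖ ^ 2)
      (∫ t in x..(x + 2 * Real.pi), ‖∑' i : ℕ, c i * circleChar i t‖ ^ 2) := by
  have hcont := continuous_tsum_circleChar hc (fun i : ℕ => (i : ℤ))
  have h := hasSum_mul_integral_circleChar hc (fun i : ℕ => (i : ℤ))
    (Complex.continuous_conj.comp hcont) x (x + 2 * Real.pi)
  have h2 : ∀ i : ℕ, ∫ t in x..(x + 2 * Real.pi), circleChar i t *
      ((starRingEnd ℂ) ∘ fun t => ∑' i : ℕ, c i * circleChar i t) t =
      2 * Real.pi * (starRingEnd ℂ) (c i) := by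
    intro i
    have := integral_circleChar_mul_tsum hc x (-i)
    rw [if_pos (by omega)] at this
    have h4 := congrArg (starRingEnd ℂ) this
    rw [← intervalIntegral.intervalIntegral_conj] at h4
    simpa [conj_circleChar, Complex.conj_ofNat] using h4
  simp_rw [h2] at h
  rw [← Complex.hasSum_ofReal, ← intervalIntegral.integral_ofReal]
  convert h using 1
  · ext i
    rw [mul_left_comm, Complex.mul_conj']
    push_cast; ring
  · refine intervalIntegral.integral_congr fun t _ => ?_
    simp [Complex.mul_conj']

/-- Integration by parts for Fourier integrals, when all boundary terms cancel. -/
lemma norm_integral_circleChar_mul_le {h : ℝ → ℂ} (hh : ContDiff ℝ (⊤ : ℕ∞) h) (n : ℤ) {u v : ℝ}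
    (p : ℕ) (hb : ∀ i < p, circleChar n v * iteratedDeriv i h v =
      circleChar n u * iteratedDeriv i h u) :
    |(n : ℝ)| ^ p * ‖∫ t in u..v, circleChar n t * h t‖ =
      ‖∫ t in u..v, circleChar n t * iteratedDeriv p h t‖ := by
  induction p with
  | zero => simp
  | succ p ih =>
    rw [pow_succ', mul_assoc, ih fun i hi => hb i (by omega)]
    have hderiv : ∀ t, HasDerivAt (circleChar n) (Complex.I * n * circleChar n t) t := by
      intro t
      have h1 : HasDerivAt (fun t : ℝ => Complex.I * n * (t : ℂ)) (Complex.I * n * 1) t :=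
        (Complex.ofRealCLM.hasDerivAt.const_mul _)
      have h2 : HasDerivAt (circleChar n) (circleChar n t * (Complex.I * n * 1)) t := h1.cexp
      rwa [mul_one, mul_comm] at h2
    have hderiv2 : ∀ t, HasDerivAt (iteratedDeriv p h) (iteratedDeriv (p + 1) h t) t := by
      intro t
      rw [iteratedDeriv_succ]
      exact ((hh.differentiable_iteratedDeriv p
        (by exact_mod_cast WithTop.coe_lt_top p)) t).hasDerivAt
    have hcont : ∀ i, Continuous (iteratedDeriv i h) := fun i =>
      hh.continuous_iteratedDeriv i (by exact_mod_cast le_top)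
    have key := intervalIntegral.integral_mul_deriv_eq_deriv_mul (a := u) (b := v)
      (fun t _ => hderiv t) (fun t _ => hderiv2 t)
      ((continuous_const.mul (continuous_circleChar n)).intervalIntegrable _ _)
      ((hcont (p + 1)).intervalIntegrable _ _)
    rw [hb p (by omega), sub_self, zero_sub] at key
    rw [key, norm_neg]
    simp_rw [mul_assoc, intervalIntegral.integral_const_mul]
    simp

lemma norm_integral_le_of_periodic {h : ℝ → ℂ} (hh : ContDiff ℝ (⊤ : ℕ∞) h)
    (hp : Function.Periodic h (2 * Real.pi)) (p : ℕ) :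
    ∃ C, ∀ n : ℤ, |(n : ℝ)| ^ p * ‖∫ t in (0 : ℝ)..(2 * Real.pi), circleChar n t * h t‖ ≤ C := by
  have hper : ∀ i, iteratedDeriv i h (2 * Real.pi) = iteratedDeriv i h 0 := by
    intro i
    have h1 : (fun t => h (t + 2 * Real.pi)) = h := funext hp
    have h2 := iteratedDeriv_comp_add_const i h (2 * Real.pi)
    rw [h1] at h2
    have := congrFun h2 0
    simpa using this.symm
  have hcont := hh.continuous_iteratedDeriv p (by exact_mod_cast le_top)
  refine ⟨∫ t in (0 : ℝ)..(2 * Real.pi), ‖iteratedDeriv p h t‖, fun n => ?_⟩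
  rw [norm_integral_circleChar_mul_le hh n p]
  · refine (intervalIntegral.norm_integral_le_integral_norm (by positivity)).trans ?_
    simp
  · intro i _
    rw [hper]
    congr 1
    simpa using circleChar_periodic n 0

/-- Smooth non-negative `2π`-periodic function, positive exactly where `cos t > c`. -/
noncomputable def cosBump (c t : ℝ) : ℝ := expNegInvGlue (Real.cos t - c)

lemma contDiff_cosBump (c : ℝ) : ContDiff ℝ (⊤ : ℕ∞) (cosBump c) :=
  expNegInvGlue.contDiff.comp (Real.contDiff_cos.sub contDiff_const)

lemma cosBump_nonneg (c t : ℝ) : 0 ≤ cosBump c t := expNegInvGlue.nonneg _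

lemma cosBump_eq_zero {c t : ℝ} (h : Real.cos t ≤ c) : cosBump c t = 0 :=
  expNegInvGlue.zero_of_nonpos (by linarith)

lemma cosBump_periodic (c : ℝ) : Function.Periodic (cosBump c) (2 * Real.pi) := by
  intro t; simp [cosBump]

lemma integral_cosBump_pos {c : ℝ} (hc : c < 1) :
    0 < ∫ t in (0 : ℝ)..(2 * Real.pi), cosBump c t := by
  refine intervalIntegral.integral_pos (by positivity)
    (contDiff_cosBump c).continuous.continuousOn (fun t _ => cosBump_nonneg c t)
    ⟨0, ⟨le_rfl, by positivity⟩, ?_⟩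
  simp only [cosBump, Real.cos_zero]
  exact expNegInvGlue.pos_of_pos (by linarith)

/-- The Fourier coefficients of `cosBump c`, up to normalization. -/
noncomputable def cosBumpCoeff (c : ℝ) (n : ℤ) : ℂ :=
  ∫ t in (0 : ℝ)..(2 * Real.pi), circleChar n t * cosBump c t

lemma norm_cosBumpCoeff_le (c : ℝ) (n : ℤ) :
    ‖cosBumpCoeff c n‖ ≤ ∫ t in (0 : ℝ)..(2 * Real.pi), cosBump c t := by
  refine (intervalIntegral.norm_integral_le_integral_norm (by positivity)).trans_eq ?_
  refine intervalIntegral.integral_congr fun t _ => ?_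
  simp [abs_of_nonneg (cosBump_nonneg c t)]

lemma cos_int_mul_ge (k : ℤ) {t c : ℝ} (hc : 4 * (k : ℝ) ^ 2 * (1 - c) ≤ 1)
    (ht : c ≤ Real.cos t) : 1 / 2 ≤ Real.cos (k * t) := by
  have h1 : ‖Complex.exp (Complex.I * t) - 1‖ ^ 2 = 2 - 2 * Real.cos t := by
    rw [mul_comm, Complex.exp_mul_I, ← Complex.normSq_eq_norm_sq, Complex.normSq_apply]
    simp [← Complex.ofReal_cos, ← Complex.ofReal_sin]
    nlinarith [Real.sin_sq_add_cos_sq t]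
  have h2 : ‖Complex.exp (Complex.I * (k * t : ℝ)) - 1‖ ^ 2 = 2 - 2 * Real.cos (k * t) := by
    rw [mul_comm, Complex.exp_mul_I, ← Complex.normSq_eq_norm_sq, Complex.normSq_apply]
    rw [← Complex.ofReal_cos, ← Complex.ofReal_sin]
    simp only [sub_re, add_re, ofReal_re, mul_re, I_re, I_im, ofReal_im, one_re, sub_im, add_im,
      mul_im, one_im]
    nlinarith [Real.sin_sq_add_cos_sq (k * t)]
  have hpow : ∀ (m : ℕ) (z : ℂ), ‖z‖ = 1 → ‖z ^ m - 1‖ ≤ m * ‖z - 1‖ := by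
    intro m z hz
    rw [← mul_geom_sum, norm_mul, mul_comm]
    gcongr
    refine (norm_sum_le _ _).trans ?_
    simp [hz]
  have hz : ‖Complex.exp (Complex.I * t)‖ = 1 := by simp [Complex.norm_exp]
  have h3 : ‖Complex.exp (Complex.I * (k * t : ℝ)) - 1‖ ≤ |(k : ℝ)| *
      ‖Complex.exp (Complex.I * t) - 1‖ := by
    have : Complex.exp (Complex.I * (k * t : ℝ)) = Complex.exp (Complex.I * t) ^ k := by
      rw [← Complex.exp_int_mul]; congr 1; push_cast; ring
    rw [this]
    obtain ⟨m, rfl | rfl⟩ := k.eq_nat_or_neg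
    · simpa using hpow m _ hz
    · have h5 := hpow m _ hz
      have h6 : Complex.exp (Complex.I * t) ^ (-(m : ℤ)) - 1 =
          -(Complex.exp (Complex.I * t) ^ (-(m : ℤ)) * (Complex.exp (Complex.I * t) ^ m - 1)) := by
        rw [zpow_neg, zpow_natCast]
        field_simp
        ring
      rw [h6, norm_neg, norm_mul, norm_zpow, hz]
      simpa using h5
  have h4 := mul_self_le_mul_self (norm_nonneg _) h3
  rw [← pow_two, h2, mul_mul_mul_comm, abs_mul_abs_self, ← pow_two, ← pow_two, h1] at h4
  nlinarith [sq_nonneg (k : ℝ)]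

lemma le_norm_cosBumpCoeff (k : ℤ) {c : ℝ} (hc : 4 * (k : ℝ) ^ 2 * (1 - c) ≤ 1) :
    (∫ t in (0 : ℝ)..(2 * Real.pi), cosBump c t) / 2 ≤ ‖cosBumpCoeff c k‖ := by
  refine le_trans ?_ (Complex.re_le_norm _)
  have hcosBump : IntervalIntegrable (fun t => circleChar k t * (cosBump c t : ℂ)) volume 0
      (2 * Real.pi) :=
    ((continuous_circleChar k).mul
      (Complex.continuous_ofReal.comp (contDiff_cosBump c).continuous)).intervalIntegrable _ _
  have h1 : (cosBumpCoeff c k).re =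
      ∫ t in (0 : ℝ)..(2 * Real.pi), Real.cos (k * t) * cosBump c t := by
    have := Complex.reCLM.intervalIntegral_comp_comm hcosBump
    simp only [Complex.reCLM_apply] at this
    rw [cosBumpCoeff, ← this]
    refine intervalIntegral.integral_congr fun t _ => ?_
    have : circleChar k t = Complex.exp ((k * t : ℝ) * Complex.I) := by
      rw [circleChar]; push_cast; ring_nf
    simp only [this, Complex.re_mul_ofReal, Complex.exp_ofReal_mul_I_re]
  rw [h1, ← intervalIntegral.integral_div]
  have hcb := (contDiff_cosBump c).continuous
  refine intervalIntegral.integral_mono_on (by positivity)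
    ((hcb.div_const 2).intervalIntegrable _ _)
    (Continuous.intervalIntegrable (by fun_prop) _ _) fun t _ => ?_
  rcases le_total (Real.cos t) c with h | h
  · simp [cosBump_eq_zero h]
  · nlinarith [cos_int_mul_ge k hc h, cosBump_nonneg c t]

/-- The Taylor coefficients of `G` at the origin. -/
noncomputable def taylorCoeff (G : ℂ → ℂ) (n : ℕ) : ℂ := (n.factorial : ℂ)⁻¹ * iteratedDeriv n G 0

lemma taylorCoeff_deriv (G : ℂ → ℂ) (n : ℕ) :
    taylorCoeff (deriv G) n = (n + 1) * taylorCoeff G (n + 1) := by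
  simp only [taylorCoeff, iteratedDeriv_succ', Nat.factorial_succ]
  have : (n.factorial : ℂ) ≠ 0 := by exact_mod_cast n.factorial_ne_zero
  have : (n + 1 : ℂ) ≠ 0 := by exact_mod_cast n.succ_ne_zero
  push_cast
  field_simp

lemma hasSum_taylorCoeff {G : ℂ → ℂ} {R : ℝ} (hG : DifferentiableOn ℂ G (Metric.ball 0 R))
    {z : ℂ} (hz : ‖z‖ < R) : HasSum (fun n => taylorCoeff G n * z ^ n) (G z) := by
  have := Complex.hasSum_taylorSeries_on_ball hG (z := z) (by simpa using hz)
  refine this.congr_fun fun n => ?_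
  simp [taylorCoeff]; ring

lemma summable_norm_taylorCoeff {G : ℂ → ℂ} {R : ℝ} (hG : DifferentiableOn ℂ G (Metric.ball 0 R))
    {r : ℝ} (hr0 : 0 ≤ r) (hr : r < R) : Summable fun n => ‖taylorCoeff G n * (r : ℂ) ^ n‖ :=
  summable_norm_iff.mpr
    (hasSum_taylorCoeff hG (z := r) (by rwa [norm_real, Real.norm_of_nonneg hr0])).summable

lemma eq_tsum_taylorCoeff_circleChar {G : ℂ → ℂ} {R : ℝ}
    (hG : DifferentiableOn ℂ G (Metric.ball 0 R)) {r : ℝ} (hr0 : 0 ≤ r) (hr : r < R) (t : ℝ) :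
    G (r * Complex.exp (Complex.I * t)) =
      ∑' n : ℕ, taylorCoeff G n * (r : ℂ) ^ n * circleChar n t := by
  rw [← (hasSum_taylorCoeff hG (z := r * Complex.exp (Complex.I * t)) _).tsum_eq]
  · refine tsum_congr fun n => ?_
    rw [mul_pow, ← Complex.exp_nat_mul, circleChar, mul_assoc]
    congr 3
    push_cast; ring
  · rw [norm_mul, norm_real, Real.norm_of_nonneg hr0]
    simpa [Complex.norm_exp] using hr

/-- Weighted `ℓ²` bound on the Taylor coefficients of a bounded analytic function, from a growth
bound for the integral means of its derivative. -/
lemma sum_rpow_mul_sq_taylorCoeff_le {α β : ℝ} (hβ : 0 < β) (hβα : β < α) :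
    ∃ C, 0 ≤ C ∧ ∀ (G : ℂ → ℂ) (R B : ℝ), 1 < R → DifferentiableOn ℂ G (Metric.ball 0 R) →
      (∀ z, ‖z‖ ≤ 1 → ‖G z‖ ≤ 1) → 0 ≤ B →
      (∀ r : ℝ, 0 ≤ r → r < 1 → ∫ t in (0 : ℝ)..(0 + 2 * Real.pi),
        ‖deriv G (r * Complex.exp (Complex.I * t))‖ ≤ B * (1 - r) ^ (-β)) →
      ∀ T : Finset ℕ, ∑ j ∈ T, ((j + 1 : ℕ) : ℝ) ^ (1 - α) * ‖taylorCoeff G (j + 1)‖ ^ 2 ≤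
        C * B := by
  set q : ℝ := (2 : ℝ) ^ (β - α) with hq
  have hq0 : 0 < q := by positivity
  have hq1 : q < 1 := Real.rpow_lt_one_of_one_lt_of_neg (by norm_num) (by linarith)
  have hgeo := summable_geometric_of_lt_one hq0.le hq1
  refine ⟨2 * 8 ^ (1 + β) / (2 * Real.pi) * ∑' i : ℕ, q ^ i, by positivity, ?_⟩
  intro G R B hR hG hG1 hB hmean T
  have hG' : DifferentiableOn ℂ (deriv G) (Metric.ball 0 R) := hG.deriv Metric.isOpen_ball
  have hD : ∀ r : ℝ, 0 ≤ r → r < 1 →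
      ∑ j ∈ T, (((j + 1 : ℕ) : ℝ) * ‖taylorCoeff G (j + 1)‖ * r ^ j) ^ 2 ≤
        B * (1 - r) ^ (-(1 + β)) / (2 * Real.pi) := by
    intro r hr0 hr
    have h1 := hasSum_sq_norm_integral (summable_norm_taylorCoeff hG' hr0 (hr.trans hR)) 0
    simp_rw [← eq_tsum_taylorCoeff_circleChar hG' hr0 (hr.trans hR)] at h1
    have h2 : ∫ t in (0 : ℝ)..(0 + 2 * Real.pi),
        ‖deriv G (r * Complex.exp (Complex.I * t))‖ ^ 2 ≤ B * (1 - r) ^ (-(1 + β)) := by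
      have hcont : Continuous fun t : ℝ => deriv G (r * Complex.exp (Complex.I * t)) := by
        refine hG'.continuousOn.comp_continuous (by fun_prop) fun t => ?_
        rw [mem_ball_zero_iff, norm_mul, norm_real, Real.norm_of_nonneg hr0]
        simpa [Complex.norm_exp] using hr.trans hR
      have h3 : ∀ t : ℝ, ‖deriv G (r * Complex.exp (Complex.I * t))‖ ≤ 1 / (1 - r) := by
        intro t
        have hn : ‖(r : ℂ) * Complex.exp (Complex.I * t)‖ = r := by
          rw [norm_mul, norm_real, Real.norm_of_nonneg hr0]
          simp [Complex.norm_exp]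
        have hsub : ∀ w ∈ Metric.closedBall ((r : ℂ) * Complex.exp (Complex.I * t)) (1 - r),
            ‖w‖ ≤ 1 := by
          intro w hw
          have := norm_le_norm_add_norm_sub' w ((r : ℂ) * Complex.exp (Complex.I * t))
          rw [mem_closedBall_iff_norm] at hw
          linarith
        refine Complex.norm_deriv_le_of_forall_mem_sphere_norm_le (by linarith) ?_
          fun w hw => hG1 w (hsub w (Metric.sphere_subset_closedBall hw))
        refine (hG.mono fun w hw => ?_).diffContOnCl_ball (U := Metric.ball 0 R) ?_
        · exact hw
        · intro w hw
          simpa using (hsub w hw).trans_lt hR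
      calc _ ≤ ∫ t in (0 : ℝ)..(0 + 2 * Real.pi), 1 / (1 - r) *
            ‖deriv G (r * Complex.exp (Complex.I * t))‖ := by
            refine intervalIntegral.integral_mono_on (by linarith [Real.pi_pos])
              ((hcont.norm.pow 2).intervalIntegrable _ _)
              ((continuous_const.mul hcont.norm).intervalIntegrable _ _) fun t _ => ?_
            rw [pow_two]
            exact mul_le_mul_of_nonneg_right (h3 t) (norm_nonneg _)
        _ ≤ 1 / (1 - r) * (B * (1 - r) ^ (-β)) := by
            rw [intervalIntegral.integral_const_mul]
            have : 0 < 1 - r := by linarith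
            gcongr
            exact hmean r hr0 hr
        _ = _ := by
            have : 0 < 1 - r := by linarith
            rw [neg_add, Real.rpow_add this, Real.rpow_neg_one]; ring
    have h4 := sum_le_hasSum T (fun i _ => by positivity) h1
    rw [le_div_iff₀ (by positivity), Finset.sum_mul]
    refine le_trans (le_of_eq ?_) (h4.trans h2)
    refine Finset.sum_congr rfl fun j _ => ?_
    rw [taylorCoeff_deriv, norm_mul, norm_mul, norm_pow, norm_real, Real.norm_of_nonneg hr0]
    have : ‖(j + 1 : ℂ)‖ = ((j + 1 : ℕ) : ℝ) := by
      rw [← Complex.norm_natCast]; push_cast; rfl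
    rw [this]; ring
  have hterm : ∀ j : ℕ, ((j + 1 : ℕ) : ℝ) ^ (1 - α) * ‖taylorCoeff G (j + 1)‖ ^ 2 ≤
      2 * ((2 : ℝ) ^ Nat.log 2 (j + 1)) ^ (-(1 + α)) * (((j + 1 : ℕ) : ℝ) *
        ‖taylorCoeff G (j + 1)‖ * (1 - 1 / 2 ^ (Nat.log 2 (j + 1) + 3)) ^ j) ^ 2 := by
    intro j
    have hl : 2 ^ Nat.log 2 (j + 1) ≤ j + 1 := Nat.pow_log_le_self 2 (by omega)
    have hu : j + 1 < 2 ^ (Nat.log 2 (j + 1) + 1) := Nat.lt_pow_succ_log_self (by norm_num) _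
    set i := Nat.log 2 (j + 1)
    have hl' : (2 : ℝ) ^ i ≤ ((j + 1 : ℕ) : ℝ) := by exact_mod_cast hl
    have hu' : ((j + 1 : ℕ) : ℝ) < 2 ^ (i + 1) := by exact_mod_cast hu
    have h1 : 1 / 2 ≤ ((1 - 1 / 2 ^ (i + 3) : ℝ) ^ j) ^ 2 := by
      rw [← pow_mul]
      have hle : (1 : ℝ) / 2 ^ (i + 3) ≤ 1 :=
        div_le_one_of_le₀ (one_le_pow₀ (by norm_num)) (by positivity)
      have h2 := one_add_mul_le_pow (a := -(1 / 2 ^ (i + 3) : ℝ)) (by linarith) (j * 2)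
      rw [← sub_eq_add_neg] at h2
      refine le_trans ?_ h2
      have h3 : ((j * 2 : ℕ) : ℝ) * (1 / 2 ^ (i + 3)) ≤ 1 / 2 := by
        rw [mul_one_div, div_le_iff₀ (by positivity)]
        push_cast at hu' ⊢
        have : (2 : ℝ) ^ (i + 3) = 4 * 2 ^ (i + 1) := by ring
        rw [this]; linarith
      linarith
    have hj : (0 : ℝ) < ((j + 1 : ℕ) : ℝ) := by positivity
    have h5 : ((j + 1 : ℕ) : ℝ) ^ (1 - α) =
        ((j + 1 : ℕ) : ℝ) ^ (-(1 + α)) * ((j + 1 : ℕ) : ℝ) ^ 2 := by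
      rw [← Real.rpow_natCast, ← Real.rpow_add hj]; congr 1; push_cast; ring
    have h6 : ((j + 1 : ℕ) : ℝ) ^ (-(1 + α)) ≤ ((2 : ℝ) ^ i) ^ (-(1 + α)) :=
      Real.rpow_le_rpow_of_nonpos (by positivity) hl' (by linarith)
    rw [h5]
    calc _ ≤ ((2 : ℝ) ^ i) ^ (-(1 + α)) * ((j + 1 : ℕ) : ℝ) ^ 2 * ‖taylorCoeff G (j + 1)‖ ^ 2 := by
            gcongr
      _ = 2 * ((2 : ℝ) ^ i) ^ (-(1 + α)) * ((j + 1 : ℕ) : ℝ) ^ 2 *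
            ‖taylorCoeff G (j + 1)‖ ^ 2 * (1 / 2) := by ring
      _ ≤ 2 * ((2 : ℝ) ^ i) ^ (-(1 + α)) * ((j + 1 : ℕ) : ℝ) ^ 2 *
            ‖taylorCoeff G (j + 1)‖ ^ 2 * ((1 - 1 / 2 ^ (i + 3) : ℝ) ^ j) ^ 2 := by gcongr
      _ = _ := by ring
  set I := T.sup (fun j => Nat.log 2 (j + 1)) + 1
  calc _ ≤ ∑ j ∈ T, ∑ i ∈ Finset.range I, 2 * ((2 : ℝ) ^ i) ^ (-(1 + α)) * (((j + 1 : ℕ) : ℝ) *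
        ‖taylorCoeff G (j + 1)‖ * (1 - 1 / 2 ^ (i + 3)) ^ j) ^ 2 := by
        refine Finset.sum_le_sum fun j hj => (hterm j).trans ?_
        refine Finset.single_le_sum (f := fun i => 2 * ((2 : ℝ) ^ i) ^ (-(1 + α)) *
          (((j + 1 : ℕ) : ℝ) * ‖taylorCoeff G (j + 1)‖ * (1 - 1 / 2 ^ (i + 3)) ^ j) ^ 2)
          (fun i _ => by positivity) ?_
        rw [Finset.mem_range, Nat.lt_succ_iff]
        exact Finset.le_sup (f := fun j => Nat.log 2 (j + 1)) hj
    _ = ∑ i ∈ Finset.range I, 2 * ((2 : ℝ) ^ i) ^ (-(1 + α)) * ∑ j ∈ T, (((j + 1 : ℕ) : ℝ) *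
        ‖taylorCoeff G (j + 1)‖ * (1 - 1 / 2 ^ (i + 3)) ^ j) ^ 2 := by
        rw [Finset.sum_comm]
        simp_rw [Finset.mul_sum]
    _ ≤ ∑ i ∈ Finset.range I, 2 * 8 ^ (1 + β) / (2 * Real.pi) * B * q ^ i := by
        refine Finset.sum_le_sum fun i _ => ?_
        have h8 : (1 : ℝ) < 2 ^ (i + 3) := one_lt_pow₀ (by norm_num) (by omega)
        have h7 := hD (1 - 1 / 2 ^ (i + 3))
          (by rw [sub_nonneg]; exact div_le_one_of_le₀ h8.le (by positivity))
          (by linarith [show (0 : ℝ) < 1 / 2 ^ (i + 3) by positivity])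
        refine (mul_le_mul_of_nonneg_left h7 (by positivity)).trans_eq ?_
        have h9 : (1 - (1 - 1 / 2 ^ (i + 3)) : ℝ) ^ (-(1 + β)) =
            8 ^ (1 + β) * ((2 : ℝ) ^ i) ^ (1 + β) := by
          rw [sub_sub_cancel, one_div, Real.inv_rpow (by positivity), Real.rpow_neg (by positivity),
            inv_inv, ← Real.mul_rpow (by positivity) (by positivity)]
          congr 1; ring
        have h10 : ((2 : ℝ) ^ i) ^ (-(1 + α)) * ((2 : ℝ) ^ i) ^ (1 + β) = q ^ i := by
          rw [← Real.rpow_add (by positivity), hq, ← Real.rpow_natCast, ← Real.rpow_natCast,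
            ← Real.rpow_mul (by norm_num), ← Real.rpow_mul (by norm_num)]
          congr 1; ring
        rw [h9, ← h10]; ring
    _ = 2 * 8 ^ (1 + β) / (2 * Real.pi) * B * ∑ i ∈ Finset.range I, q ^ i := by
        rw [Finset.mul_sum]
    _ ≤ 2 * 8 ^ (1 + β) / (2 * Real.pi) * B * ∑' i, q ^ i := by
        gcongr
        exact hgeo.sum_le_tsum _ fun i _ => by positivity
    _ = _ := by ring

/-- Rational function vanishing at `e^{ie}`, bounded by `1` on the unit disc and close to `1` away
from the scale `η` around `e^{ie}`. -/
noncomputable def vanishFactor (e η : ℝ) (z : ℂ) : ℂ :=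
  (1 - z * circleChar (-1) e) / (1 + η - z * circleChar (-1) e)

lemma vanishFactor_denom_ne_zero {e η : ℝ} {z : ℂ} (hη : 0 < η) (hz : ‖z‖ < 1 + η) :
    1 + η - z * circleChar (-1) e ≠ 0 := by
  intro h
  have h1 : z * circleChar (-1) e = ((1 + η : ℝ) : ℂ) := by
    push_cast; exact (sub_eq_zero.mp h).symm
  have h2 := congrArg norm h1
  rw [norm_mul, norm_circleChar, mul_one, norm_real, Real.norm_of_nonneg (by linarith)] at h2
  linarith

/-- Bound for `q / (q + η)` when the real part of `q` is not too negative. -/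
lemma norm_div_add_le_exp {q : ℂ} {η : ℝ} (hη : 0 ≤ η) (hη1 : 4 * η ≤ 1)
    (hq : 0 < ‖q‖) (hre : -‖q‖ ^ 2 ≤ q.re) : ‖q / (q + η)‖ ≤ Real.exp (2 * η) := by
  have h1 : ‖q + η‖ ^ 2 = ‖q‖ ^ 2 + 2 * η * q.re + η ^ 2 := by
    rw [← Complex.normSq_eq_norm_sq, ← Complex.normSq_eq_norm_sq, Complex.normSq_apply,
      Complex.normSq_apply]
    simp; ring
  have hq2 : 0 < ‖q‖ ^ 2 := by positivity
  have h2 : ‖q‖ ^ 2 * (1 - 2 * η) ≤ ‖q + η‖ ^ 2 := by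
    rw [h1]; nlinarith [sq_nonneg η]
  have h3 : 0 < ‖q + η‖ ^ 2 := lt_of_lt_of_le (mul_pos hq2 (by linarith)) h2
  have h4 : ‖q / (q + η)‖ ^ 2 ≤ (1 + 2 * η) ^ 2 := by
    rw [norm_div, div_pow, div_le_iff₀ h3]
    calc ‖q‖ ^ 2 ≤ (1 + 2 * η) ^ 2 * (‖q‖ ^ 2 * (1 - 2 * η)) := by
          have : 0 ≤ ‖q‖ ^ 2 * (η * (2 - 4 * η - 8 * η ^ 2)) :=
            mul_nonneg hq2.le (mul_nonneg hη (by nlinarith))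
          nlinarith
      _ ≤ _ := by gcongr
  have h5 := (sq_le_sq₀ (norm_nonneg _) (by positivity)).mp h4
  linarith [Real.add_one_le_exp (2 * η)]

lemma norm_vanishFactor_le_one {e η : ℝ} {z : ℂ} (hη : 0 < η) (hz : ‖z‖ ≤ 1) :
    ‖vanishFactor e η z‖ ≤ 1 := by
  unfold vanishFactor
  have hw : ‖z * circleChar (-1) e‖ ≤ 1 := by simpa using hz
  have hre := (Complex.re_le_norm (z * circleChar (-1) e)).trans hw
  rw [norm_div]
  refine div_le_one_of_le₀ ?_ (norm_nonneg _)
  rw [← sq_le_sq₀ (norm_nonneg _) (norm_nonneg _), ← Complex.normSq_eq_norm_sq,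
    ← Complex.normSq_eq_norm_sq, Complex.normSq_apply, Complex.normSq_apply]
  simp only [sub_re, one_re, add_re, ofReal_re, sub_im, one_im, add_im, ofReal_im]
  nlinarith

lemma hasDerivAt_vanishFactor {e η : ℝ} {z : ℂ} (hη : 0 < η) (hz : ‖z‖ < 1 + η) :
    HasDerivAt (vanishFactor e η)
      (-(η * circleChar (-1) e) / (1 + η - z * circleChar (-1) e) ^ 2) z := by
  have h1 : HasDerivAt (fun z => z * circleChar (-1) e) (circleChar (-1) e) z := by
    simpa using (hasDerivAt_id z).mul_const (circleChar (-1) e)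
  refine ((h1.const_sub 1).div (h1.const_sub (1 + η : ℂ))
    (vanishFactor_denom_ne_zero hη hz)).congr_deriv ?_
  ring

/-- Finite product of powers of vanishing factors. -/
noncomputable def vanishProd {ι : Type*} (s : Finset ι) (e η : ι → ℝ) (P : ℕ) (z : ℂ) : ℂ :=
  ∏ i ∈ s, vanishFactor (e i) (η i) z ^ P

section vanishProd

variable {ι : Type*} {s : Finset ι} {e η : ι → ℝ} {P : ℕ}

lemma norm_vanishProd_le_one (hη : ∀ i ∈ s, 0 < η i) {z : ℂ} (hz : ‖z‖ ≤ 1) :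
    ‖vanishProd s e η P z‖ ≤ 1 := by
  unfold vanishProd
  rw [norm_prod]
  refine Finset.prod_le_one (fun i _ => norm_nonneg _) fun i hi => ?_
  rw [norm_pow]
  exact pow_le_one₀ (norm_nonneg _) (norm_vanishFactor_le_one (hη i hi) hz)

lemma hasDerivAt_vanishProd [DecidableEq ι] (hη : ∀ i ∈ s, 0 < η i) {z : ℂ}
    (hz : ∀ i ∈ s, ‖z‖ < 1 + η i) :
    HasDerivAt (vanishProd s e η P) (∑ i ∈ s, (∏ j ∈ s.erase i, vanishFactor (e j) (η j) z ^ P) •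
      (P * vanishFactor (e i) (η i) z ^ (P - 1) *
      (-(η i * circleChar (-1) (e i)) / (1 + η i - z * circleChar (-1) (e i)) ^ 2))) z :=
  HasDerivAt.fun_finsetProd fun i hi => (hasDerivAt_vanishFactor (hη i hi) (hz i hi)).pow P

lemma differentiableOn_vanishProd (hη : ∀ i ∈ s, 0 < η i) {R : ℝ} (hR : ∀ i ∈ s, R ≤ 1 + η i) :
    DifferentiableOn ℂ (vanishProd s e η P) (Metric.ball 0 R) := by
  classical
  intro z hz
  rw [mem_ball_zero_iff] at hz
  exact (hasDerivAt_vanishProd hη fun i hi =>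
    hz.trans_le (hR i hi)).differentiableAt.differentiableWithinAt

lemma norm_deriv_vanishProd_le (hη : ∀ i ∈ s, 0 < η i) {z : ℂ} (hz : ‖z‖ ≤ 1) :
    ‖deriv (vanishProd s e η P) z‖ ≤
      ∑ i ∈ s, P * (η i * ‖(1 + η i - z * circleChar (-1) (e i))⁻¹‖ ^ 2) := by
  classical
  rw [(hasDerivAt_vanishProd hη fun i hi => by linarith [hη i hi]).deriv]
  refine (norm_sum_le _ _).trans (Finset.sum_le_sum fun i hi => ?_)
  rw [norm_smul, norm_prod, norm_mul, norm_mul, norm_div, norm_neg, norm_mul, norm_circleChar,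
    mul_one, norm_real, Real.norm_of_nonneg (hη i hi).le, norm_pow, norm_pow, norm_natCast,
    norm_inv, inv_pow, ← div_eq_mul_inv]
  have h1 : ∏ j ∈ s.erase i, ‖vanishFactor (e j) (η j) z ^ P‖ ≤ 1 := by
    refine Finset.prod_le_one (fun i _ => norm_nonneg _) fun j hj => ?_
    rw [norm_pow]
    exact pow_le_one₀ (norm_nonneg _)
      (norm_vanishFactor_le_one (hη j (Finset.mem_of_mem_erase hj)) hz)
  have h2 : ‖vanishFactor (e i) (η i) z‖ ^ (P - 1) ≤ 1 :=
    pow_le_one₀ (norm_nonneg _) (norm_vanishFactor_le_one (hη i hi) hz)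
  have h3 : 0 ≤ η i / ‖1 + η i - z * circleChar (-1) (e i)‖ ^ 2 :=
    div_nonneg (hη i hi).le (by positivity)
  calc _ ≤ 1 * (P * 1 * (η i / ‖1 + η i - z * circleChar (-1) (e i)‖ ^ 2)) := by gcongr
    _ = _ := by ring

lemma integral_norm_inv_sq {e η r : ℝ} (hη : 0 < η) (hr0 : 0 ≤ r) (hr : r < 1) :
    ∫ t in (0 : ℝ)..(0 + 2 * Real.pi),
      ‖(1 + η - r * Complex.exp (Complex.I * t) * circleChar (-1) e)⁻¹‖ ^ 2 =
      2 * Real.pi / ((1 + η) ^ 2 - r ^ 2) := by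
  set c : ℕ → ℂ := fun n => (1 + η : ℂ)⁻¹ * ((r / (1 + η) : ℝ) * circleChar (-1) e) ^ n with hc
  have hq : r / (1 + η) < 1 := by rw [div_lt_one (by linarith)]; linarith
  have hq0 : 0 ≤ r / (1 + η) := by positivity
  have hnorm : ∀ n, ‖c n‖ = (1 + η)⁻¹ * (r / (1 + η)) ^ n := by
    intro n
    have : (1 + η : ℂ) = ((1 + η : ℝ) : ℂ) := by push_cast; rfl
    simp only [hc]
    rw [norm_mul, norm_inv, this, norm_real, Real.norm_of_nonneg (by linarith), norm_pow, norm_mul,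
      norm_circleChar, norm_real, Real.norm_of_nonneg hq0, mul_one]
  have hsum : Summable fun n => ‖c n‖ := by
    simp_rw [hnorm]
    exact (summable_geometric_of_lt_one hq0 hq).mul_left _
  have h := hasSum_sq_norm_integral hsum 0
  have hη' : (1 + η : ℂ) ≠ 0 := by exact_mod_cast (by linarith : (1 + η : ℝ) ≠ 0)
  have heval : ∀ t : ℝ, ∑' i : ℕ, c i * circleChar i t =
      (1 + η - r * Complex.exp (Complex.I * t) * circleChar (-1) e)⁻¹ := by
    intro t
    have h1 : ∀ i : ℕ, c i * circleChar i t = (1 + η : ℂ)⁻¹ *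
        ((r / (1 + η) : ℝ) * circleChar (-1) e * Complex.exp (Complex.I * t)) ^ i := by
      intro i
      have : circleChar i t = Complex.exp (Complex.I * t) ^ i := by
        rw [← Complex.exp_nat_mul, circleChar]; congr 1; push_cast; ring
      rw [this, mul_pow _ (Complex.exp (Complex.I * t)), ← mul_assoc]
    simp_rw [h1]
    rw [tsum_mul_left, tsum_geometric_of_norm_lt_one, ← mul_inv]
    · congr 1
      push_cast
      field_simp
    · rw [norm_mul, norm_mul, norm_circleChar, norm_real, Real.norm_of_nonneg hq0]
      simpa [Complex.norm_exp] using hq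
  simp_rw [heval] at h
  refine h.unique ?_
  simp_rw [hnorm, mul_pow, ← pow_mul, mul_comm _ 2, pow_mul]
  have hg := hasSum_geometric_of_lt_one (sq_nonneg (r / (1 + η)))
    (pow_lt_one₀ hq0 hq (two_ne_zero))
  have heq : 2 * Real.pi / ((1 + η) ^ 2 - r ^ 2) =
      2 * Real.pi * ((1 + η)⁻¹ ^ 2 * (1 - (r / (1 + η)) ^ 2)⁻¹) := by
    rw [inv_pow, ← mul_inv, mul_sub, mul_one, div_pow, mul_div_cancel₀ _ (by positivity),
      div_eq_mul_inv]
  rw [heq]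
  exact (hg.mul_left ((1 + η)⁻¹ ^ 2)).mul_left (2 * Real.pi)

lemma integral_norm_deriv_vanishProd_le (hη : ∀ i ∈ s, 0 < η i) {β : ℝ} (hβ0 : 0 < β) (hβ1 : β < 1)
    {r : ℝ} (hr0 : 0 ≤ r) (hr : r < 1) :
    ∫ t in (0 : ℝ)..(0 + 2 * Real.pi),
      ‖deriv (vanishProd s e η P) (r * Complex.exp (Complex.I * t))‖ ≤
      (2 * Real.pi * P * ∑ i ∈ s, η i ^ β) * (1 - r) ^ (-β) := by
  have hz : ∀ t : ℝ, ‖(r : ℂ) * Complex.exp (Complex.I * t)‖ = r := by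
    intro t
    rw [norm_mul, norm_real, Real.norm_of_nonneg hr0]
    simp [Complex.norm_exp]
  have hcont : ∀ i ∈ s, Continuous fun t : ℝ => (P : ℝ) * (η i *
      ‖(1 + η i - r * Complex.exp (Complex.I * t) * circleChar (-1) (e i))⁻¹‖ ^ 2) := by
    intro i hi
    refine continuous_const.mul
      (continuous_const.mul ((Continuous.inv₀ (by fun_prop) ?_).norm.pow 2))
    intro t
    exact vanishFactor_denom_ne_zero (hη i hi) (by rw [hz]; linarith [hη i hi])
  calc _ ≤ ∫ t in (0 : ℝ)..(0 + 2 * Real.pi), ∑ i ∈ s, (P : ℝ) * (η i *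
      ‖(1 + η i - r * Complex.exp (Complex.I * t) * circleChar (-1) (e i))⁻¹‖ ^ 2) := by
        refine intervalIntegral.integral_mono_on (by linarith [Real.pi_pos])
          (Continuous.intervalIntegrable ?_ _ _)
          ((continuous_finsetSum _ hcont).intervalIntegrable _ _) fun t _ =>
            norm_deriv_vanishProd_le hη (by rw [hz]; exact hr.le)
        have hd : DifferentiableOn ℂ (deriv (vanishProd s e η P)) (Metric.ball 0 1) :=
          (differentiableOn_vanishProd hη fun i hi => by linarith [hη i hi]).deriv
            Metric.isOpen_ball
        exact (hd.continuousOn.comp_continuous (by fun_prop) fun t => by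
          rwa [mem_ball_zero_iff, hz]).norm
    _ = ∑ i ∈ s, P * (η i * (2 * Real.pi / ((1 + η i) ^ 2 - r ^ 2))) := by
        rw [intervalIntegral.integral_finsetSum fun i hi => (hcont i hi).intervalIntegrable _ _]
        refine Finset.sum_congr rfl fun i hi => ?_
        rw [intervalIntegral.integral_const_mul, intervalIntegral.integral_const_mul,
          integral_norm_inv_sq (hη i hi) hr0 hr]
    _ ≤ ∑ i ∈ s, 2 * Real.pi * P * (η i ^ β * (1 - r) ^ (-β)) := by
        refine Finset.sum_le_sum fun i hi => ?_
        have hi' := hη i hi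
        have hr' : 0 < 1 - r := by linarith
        have h1 : η i ^ (1 - β) * (1 - r) ^ β ≤ (1 + η i) ^ 2 - r ^ 2 := by
          have := Real.geom_mean_le_arith_mean2_weighted (w₁ := 1 - β) (w₂ := β) (by linarith)
            hβ0.le hi'.le hr'.le (by ring)
          nlinarith
        have h2 : η i / ((1 + η i) ^ 2 - r ^ 2) ≤ η i ^ β * (1 - r) ^ (-β) := by
          rw [div_le_iff₀ (lt_of_lt_of_le (by positivity) h1)]
          calc η i = η i ^ β * (1 - r) ^ (-β) * (η i ^ (1 - β) * (1 - r) ^ β) := by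
                rw [mul_mul_mul_comm, ← Real.rpow_add hi', ← Real.rpow_add hr']
                simp
            _ ≤ _ := by gcongr
        calc _ = 2 * Real.pi * P * (η i / ((1 + η i) ^ 2 - r ^ 2)) := by ring
          _ ≤ _ := by gcongr
    _ = _ := by rw [← Finset.mul_sum, ← Finset.sum_mul]; ring

lemma half_le_norm_vanishProd_zero (hη : ∀ i ∈ s, 0 < η i) (hP : P * ∑ i ∈ s, η i ≤ 1 / 2) :
    1 / 2 ≤ ‖vanishProd s e η P 0‖ := by
  have h1 : Real.exp (-(P * ∑ i ∈ s, η i)) ≤ ‖vanishProd s e η P 0‖ := by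
    unfold vanishProd
    rw [norm_prod, Finset.mul_sum, ← Finset.sum_neg_distrib, Real.exp_sum]
    refine Finset.prod_le_prod (fun i _ => (Real.exp_pos _).le) fun i hi => ?_
    have hi' := hη i hi
    have : vanishFactor (e i) (η i) 0 = (((1 + η i)⁻¹ : ℝ) : ℂ) := by
      simp [vanishFactor]
    rw [this, norm_pow, norm_real, Real.norm_of_nonneg (by positivity), ← mul_neg,
      Real.exp_nat_mul, Real.exp_neg]
    gcongr
    linarith [Real.add_one_le_exp (η i)]
  linarith [Real.add_one_le_exp (-(P * ∑ i ∈ s, η i))]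

end vanishProd

lemma AnalyticAt.iteratedDeriv_complex {H : ℂ → ℂ} {z : ℂ} (hH : AnalyticAt ℂ H z) (n : ℕ) :
    AnalyticAt ℂ (iteratedDeriv n H) z := by
  induction n with
  | zero => simpa using hH
  | succ n ih => rw [iteratedDeriv_succ]; exact ih.deriv

lemma iteratedDeriv_comp_ofReal {H : ℂ → ℂ} (hH : ∀ x : ℝ, AnalyticAt ℂ H x) (n : ℕ) :
    iteratedDeriv n (fun t : ℝ => H t) = fun t : ℝ => iteratedDeriv n H t := by
  induction n with
  | zero => simp
  | succ n ih =>
    ext t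
    rw [iteratedDeriv_succ, ih, iteratedDeriv_succ]
    exact ((hH t).iteratedDeriv_complex n).differentiableAt.hasDerivAt.comp_ofReal.deriv

lemma contDiff_comp_ofReal {H : ℂ → ℂ} (hH : ∀ x : ℝ, AnalyticAt ℂ H x) :
    ContDiff ℝ (⊤ : ℕ∞) (fun t : ℝ => H t) :=
  contDiff_iff_contDiffAt.mpr fun x =>
    ((hH x).contDiffAt.restrict_scalars ℝ).comp x Complex.ofRealCLM.contDiff.contDiffAt

lemma exp_mul_circleChar (e : ℝ) (τ : ℂ) :
    Complex.exp (Complex.I * τ) * circleChar (-1) e = Complex.exp (Complex.I * (τ - e)) := by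
  rw [circleChar, ← Complex.exp_add]
  congr 1
  push_cast; ring

lemma half_le_norm_one_sub_exp {y d : ℝ} (h1 : d ≤ |y|) (h2 : d ≤ 2 * Real.pi - |y|)
    (hd : 0 ≤ d) : d / 2 ≤ ‖1 - Complex.exp (Complex.I * y)‖ := by
  have hpi := Real.pi_pos
  rw [norm_sub_rev, Complex.norm_exp_I_mul_ofReal_sub_one, Real.norm_eq_abs, abs_mul, abs_two]
  have h3 : |Real.sin (y / 2)| = |Real.sin (|y| / 2)| := by
    rcases abs_cases y with h | h <;> rw [h.1]
    rw [neg_div, Real.sin_neg, abs_neg]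
  have h4 : d / 4 ≤ Real.sin (|y| / 2) := by
    have key : ∀ x, 0 ≤ x → x ≤ Real.pi / 2 → d / 2 ≤ x → d / 4 ≤ Real.sin x := by
      intro x hx0 hx1 hx2
      refine le_trans ?_ (Real.mul_le_sin hx0 hx1)
      have : (1 / 2 : ℝ) ≤ 2 / Real.pi := by
        rw [div_le_div_iff₀ two_pos hpi]; linarith [Real.pi_le_four]
      nlinarith
    rcases le_total (|y| / 2) (Real.pi / 2) with h | h
    · exact key _ (by positivity) h (by linarith)
    · rw [← Real.sin_pi_sub]
      exact key _ (by linarith) (by linarith) (by linarith)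
  rw [h3]
  linarith [le_abs_self (Real.sin (|y| / 2))]

lemma analyticAt_vanishProd_exp {ι : Type*} {s : Finset ι} {e η : ι → ℝ} {P : ℕ} {τ : ℂ}
    (h : ∀ i ∈ s, 1 - Complex.exp (Complex.I * (τ - e i)) + η i ≠ 0) :
    AnalyticAt ℂ (fun τ => vanishProd s e η P (Complex.exp (Complex.I * τ))) τ := by
  unfold vanishProd
  refine Finset.analyticAt_fun_prod _ fun i hi => AnalyticAt.fun_pow ?_ _
  simp_rw [vanishFactor, exp_mul_circleChar]
  refine AnalyticAt.fun_div (by fun_prop) (by fun_prop) ?_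
  have := h i hi
  rwa [sub_add_eq_add_sub] at this

lemma analyticAt_vanishProd_exp_ofReal {ι : Type*} {s : Finset ι} {e η : ι → ℝ} {P : ℕ}
    (hη : ∀ i ∈ s, 0 < η i) (x : ℝ) :
    AnalyticAt ℂ (fun τ => vanishProd s e η P (Complex.exp (Complex.I * τ))) x := by
  refine analyticAt_vanishProd_exp fun i hi => ?_
  have := vanishFactor_denom_ne_zero (e := e i) (z := Complex.exp (Complex.I * x)) (hη i hi)
    (by rw [mul_comm, Complex.norm_exp_ofReal_mul_I]; linarith [hη i hi])
  rwa [exp_mul_circleChar, ← sub_add_eq_add_sub] at this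

/-- Perturbation of `1 - e^{i(x-e)}` to complex arguments near `x`. -/
lemma one_sub_exp_perturb {x e d : ℝ} {τ : ℂ} (hd : 0 < d) (hd1 : d ≤ 1)
    (hτ : ‖τ - x‖ ≤ d ^ 2 / 32) :
    ‖(1 - Complex.exp (Complex.I * (τ - e))) - (1 - Complex.exp (Complex.I * (x - e : ℝ)))‖
      ≤ d ^ 2 / 16 := by
  have h1 : (1 - Complex.exp (Complex.I * (τ - e))) - (1 - Complex.exp (Complex.I * (x - e : ℝ)))
      = -(Complex.exp (Complex.I * (x - e : ℝ)) * (Complex.exp (Complex.I * (τ - x)) - 1)) := by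
    have : Complex.I * (τ - e) = Complex.I * (x - e : ℝ) + Complex.I * (τ - x) := by
      push_cast; ring
    rw [this, Complex.exp_add]; ring
  have h2 : ‖Complex.I * (τ - x)‖ ≤ d ^ 2 / 32 := by simpa using hτ
  rw [h1, norm_neg, norm_mul, mul_comm Complex.I (x - e : ℝ), Complex.norm_exp_ofReal_mul_I,
    one_mul]
  have := Complex.norm_exp_sub_one_le (h2.trans (by nlinarith))
  linarith

lemma one_sub_exp_re_nonneg (y : ℝ) : 0 ≤ (1 - Complex.exp (Complex.I * y)).re := by
  have := Complex.re_le_norm (Complex.exp (Complex.I * y))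
  rw [mul_comm, Complex.norm_exp_ofReal_mul_I] at this
  rw [mul_comm, Complex.sub_re, Complex.one_re]
  linarith

section interval

variable {ι : Type*} {s : Finset ι} {e η : ι → ℝ} {P : ℕ} {θ x d : ℝ} {τ : ℂ}

lemma one_sub_exp_far (hd : 0 < d) (hd1 : d ≤ 1) (hτ : ‖τ - x‖ ≤ d ^ 2 / 32) {e : ℝ}
    (hfar : d / 2 ≤ ‖1 - Complex.exp (Complex.I * (x - e : ℝ))‖) :
    d / 4 ≤ ‖1 - Complex.exp (Complex.I * (τ - e))‖ ∧
    -‖1 - Complex.exp (Complex.I * (τ - e))‖ ^ 2 ≤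
      (1 - Complex.exp (Complex.I * (τ - e))).re := by
  have h1 := one_sub_exp_perturb (e := e) hd hd1 hτ
  set q := 1 - Complex.exp (Complex.I * (τ - e))
  set q₀ := 1 - Complex.exp (Complex.I * (x - e : ℝ))
  have h2 : 0 ≤ q₀.re := one_sub_exp_re_nonneg _
  have h3 : ‖q₀‖ - ‖q‖ ≤ d ^ 2 / 16 := by
    refine (norm_sub_norm_le _ _).trans ?_
    rwa [norm_sub_rev]
  have h4 : |(q - q₀).re| ≤ d ^ 2 / 16 := (Complex.abs_re_le_norm _).trans h1
  rw [Complex.sub_re] at h4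
  have h5 := (abs_le.mp h4).1
  have h6 : d / 4 ≤ ‖q‖ := by nlinarith
  exact ⟨h6, by nlinarith⟩

lemma norm_vanishProd_exp_le (hη : ∀ i ∈ s, 0 < η i) (hη4 : ∀ i ∈ s, 4 * η i ≤ 1)
    (hP : P * ∑ i ∈ s, η i ≤ 1 / 2) (hθ1 : θ < 1) (hd : 0 < d) (hd1 : d ≤ 1)
    (hfar : ∀ i ∈ s, d / 2 ≤ ‖1 - Complex.exp (Complex.I * (x - e i : ℝ))‖)
    {i₀ : ι} (hi₀ : i₀ ∈ s) (hnear : |x - e i₀| ≤ d) (hηd : d ^ θ ≤ η i₀)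
    (hτ : ‖τ - x‖ ≤ d ^ 2 / 32) :
    ‖vanishProd s e η P (Complex.exp (Complex.I * τ))‖ ≤
      4 ^ P * Real.exp 1 * d ^ ((1 - θ) * P) := by
  classical
  have hV : ∀ i, vanishFactor (e i) (η i) (Complex.exp (Complex.I * τ)) =
      (1 - Complex.exp (Complex.I * (τ - e i))) /
        ((1 - Complex.exp (Complex.I * (τ - e i))) + η i) := by
    intro i
    rw [vanishFactor, exp_mul_circleChar, sub_add_eq_add_sub]
  have hfar' : ∀ i ∈ s, ‖vanishFactor (e i) (η i) (Complex.exp (Complex.I * τ))‖ ≤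
      Real.exp (2 * η i) := by
    intro i hi
    have h := one_sub_exp_far hd hd1 hτ (hfar i hi)
    rw [hV]
    exact norm_div_add_le_exp (hη i hi).le (hη4 i hi) (by linarith) h.2
  have hnear' : ‖vanishFactor (e i₀) (η i₀) (Complex.exp (Complex.I * τ))‖ ≤
      4 * d ^ (1 - θ) := by
    have h1 := one_sub_exp_perturb (e := e i₀) hd hd1 hτ
    rw [hV]
    set q := 1 - Complex.exp (Complex.I * (τ - e i₀))
    set q₀ := 1 - Complex.exp (Complex.I * (x - e i₀ : ℝ)) with hq₀
    have h2 : 0 ≤ q₀.re := one_sub_exp_re_nonneg _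
    have h3 : ‖q₀‖ ≤ d := by
      rw [hq₀, norm_sub_rev]
      exact Real.norm_exp_I_mul_ofReal_sub_one_le.trans hnear
    have h4 : |(q - q₀).re| ≤ d ^ 2 / 16 := (Complex.abs_re_le_norm _).trans h1
    rw [Complex.sub_re] at h4
    have h5 := (abs_le.mp h4).1
    have h6 : ‖q‖ ≤ 2 * d := by
      have := norm_sub_norm_le q q₀
      nlinarith
    have h7 : d ≤ η i₀ := by
      refine le_trans ?_ hηd
      simpa using Real.rpow_le_rpow_of_exponent_ge hd hd1 hθ1.le
    have h8 : η i₀ / 2 ≤ ‖q + η i₀‖ := by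
      have := Complex.re_le_norm (q + η i₀)
      rw [Complex.add_re, Complex.ofReal_re] at this
      nlinarith
    have hpos := hη i₀ hi₀
    rw [norm_div, div_le_iff₀ (by linarith)]
    have h9 : d ^ (1 - θ) * d ^ θ = d := by
      rw [← Real.rpow_add hd]; simp
    have h10 : 0 ≤ d ^ (1 - θ) := by positivity
    calc ‖q‖ ≤ 2 * (d ^ (1 - θ) * d ^ θ) := by rw [h9]; exact h6
      _ ≤ 2 * (d ^ (1 - θ) * (2 * ‖q + η i₀‖)) := by gcongr; linarith
      _ = _ := by ring
  unfold vanishProd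
  rw [← Finset.mul_prod_erase s _ hi₀, norm_mul, norm_pow, norm_prod]
  have h1 : ‖vanishFactor (e i₀) (η i₀) (Complex.exp (Complex.I * τ))‖ ^ P ≤
      4 ^ P * d ^ ((1 - θ) * P) := by
    rw [Real.rpow_mul hd.le, Real.rpow_natCast, ← mul_pow]
    exact pow_le_pow_left₀ (norm_nonneg _) hnear' P
  have h2 : ∏ i ∈ s.erase i₀, ‖vanishFactor (e i) (η i) (Complex.exp (Complex.I * τ)) ^ P‖ ≤
      Real.exp 1 := by
    calc _ ≤ ∏ i ∈ s.erase i₀, Real.exp (P * (2 * η i)) := by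
          refine Finset.prod_le_prod (fun _ _ => norm_nonneg _) fun i hi => ?_
          rw [norm_pow, Real.exp_nat_mul]
          exact pow_le_pow_left₀ (norm_nonneg _) (hfar' i (Finset.mem_of_mem_erase hi)) P
      _ = Real.exp (2 * (P * ∑ i ∈ s.erase i₀, η i)) := by
          rw [← Real.exp_sum, ← Finset.mul_sum, ← Finset.mul_sum]; congr 1; ring
      _ ≤ _ := by
          gcongr
          have : ∑ i ∈ s.erase i₀, η i ≤ ∑ i ∈ s, η i :=
            Finset.sum_le_sum_of_subset_of_nonneg (Finset.erase_subset _ _)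
              fun i hi _ => (hη i hi).le
          have := mul_le_mul_of_nonneg_left this (Nat.cast_nonneg (α := ℝ) P)
          linarith
  calc _ ≤ 4 ^ P * d ^ ((1 - θ) * P) * Real.exp 1 := by gcongr
    _ = _ := by ring

lemma norm_iteratedDeriv_vanishProd_exp_le (hη : ∀ i ∈ s, 0 < η i) (hη4 : ∀ i ∈ s, 4 * η i ≤ 1)
    (hP : P * ∑ i ∈ s, η i ≤ 1 / 2) (hθ1 : θ < 1) (hd : 0 < d) (hd1 : d ≤ 1)
    (hfar : ∀ i ∈ s, d / 2 ≤ ‖1 - Complex.exp (Complex.I * (x - e i : ℝ))‖)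
    {i₀ : ι} (hi₀ : i₀ ∈ s) (hnear : |x - e i₀| ≤ d) (hηd : d ^ θ ≤ η i₀)
    {p : ℕ} (hpP : 2 * p + 1 ≤ (1 - θ) * P) {n : ℕ} (hn : n ≤ p) :
    ‖iteratedDeriv n (fun t : ℝ => vanishProd s e η P (Complex.exp (Complex.I * t))) x‖ ≤
      (p.factorial * 32 ^ p * 4 ^ P * Real.exp 1) * d := by
  have hlink := congrFun (iteratedDeriv_comp_ofReal
    (H := fun τ : ℂ => vanishProd s e η P (Complex.exp (Complex.I * τ)))
    (fun x => analyticAt_vanishProd_exp_ofReal hη x) n) x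
  rw [hlink]
  have hd2 : 0 < d ^ 2 / 32 := by positivity
  have hdiff : DifferentiableOn ℂ (fun τ : ℂ => vanishProd s e η P (Complex.exp (Complex.I * τ)))
      (Metric.closedBall (x : ℂ) (d ^ 2 / 32)) := by
    intro τ hτ
    rw [mem_closedBall_iff_norm] at hτ
    refine (analyticAt_vanishProd_exp fun i hi h0 => ?_).differentiableAt.differentiableWithinAt
    have h := one_sub_exp_far hd hd1 hτ (hfar i hi)
    have hi' := hη i hi
    have hi4 := hη4 i hi
    rw [eq_neg_of_add_eq_zero_left h0, norm_neg, Complex.norm_real, Complex.neg_re,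
      Complex.ofReal_re, Real.norm_of_nonneg hi'.le] at h
    nlinarith [h.2]
  refine (Complex.norm_iteratedDeriv_le_of_forall_mem_sphere_norm_le n hd2
    (C := 4 ^ P * Real.exp 1 * d ^ ((1 - θ) * P)) ?_ fun z hz => ?_).trans ?_
  · refine DifferentiableOn.diffContOnCl ?_
    rwa [closure_ball _ hd2.ne']
  · exact norm_vanishProd_exp_le hη hη4 hP hθ1 hd hd1 hfar hi₀ hnear hηd
      (mem_sphere_iff_norm.mp hz).le
  · have h1 : d ^ ((1 - θ) * P) ≤ d ^ (2 * p + 1) := by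
      rw [← Real.rpow_natCast]
      refine Real.rpow_le_rpow_of_exponent_ge hd hd1 ?_
      push_cast; exact hpP
    have h2 : d ^ (2 * p + 1) ≤ d * d ^ (2 * n) := by
      rw [pow_succ', mul_comm]
      rw [mul_comm d]
      exact mul_le_mul_of_nonneg_right (pow_le_pow_of_le_one hd.le hd1 (by omega)) hd.le
    have h3 : (n.factorial : ℝ) ≤ p.factorial := by exact_mod_cast Nat.factorial_le hn
    have h4 : (32 : ℝ) ^ n ≤ 32 ^ p := pow_le_pow_right₀ (by norm_num) hn
    calc _ = n.factorial * (32 ^ n * (4 ^ P * Real.exp 1 * d ^ ((1 - θ) * P))) / d ^ (2 * n) := by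
          rw [div_pow, ← pow_mul]; field_simp
      _ ≤ p.factorial * (32 ^ p * (4 ^ P * Real.exp 1 * (d * d ^ (2 * n)))) / d ^ (2 * n) := by
          gcongr
          exact h1.trans h2
      _ = _ := by field_simp

end interval

lemma eq_zero_endpoints_of_le {f : ℝ → ℂ} (hf : Continuous f) {u v C : ℝ} (huv : u < v)
    (h : ∀ x ∈ Set.Ioo u v, ‖f x‖ ≤ C * min (x - u) (v - x)) : f u = 0 ∧ f v = 0 := by
  have hcl : ∀ x ∈ Set.Icc u v, ‖f x‖ ≤ C * min (x - u) (v - x) := by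
    rw [← closure_Ioo huv.ne]
    intro x hx
    exact (isClosed_le hf.norm (by fun_prop : Continuous fun x => C * min (x - u) (v - x))
      ).closure_subset_iff.mpr (fun y hy => h y hy) hx
  constructor
  · have := hcl u (Set.left_mem_Icc.mpr huv.le)
    rw [sub_self, min_eq_left (by linarith), mul_zero] at this
    exact norm_le_zero_iff.mp this
  · have := hcl v (Set.right_mem_Icc.mpr huv.le)
    rw [sub_self, min_eq_right (by linarith), mul_zero] at this
    exact norm_le_zero_iff.mp this

/-- Left or right endpoint of an interval. -/
def endpoint (i : (ℝ × ℝ) × Bool) : ℝ := if i.2 then i.1.1 else i.1.2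

/-- The scale attached to an endpoint of an interval. -/
noncomputable def endpointScale (θ : ℝ) (i : (ℝ × ℝ) × Bool) : ℝ := (i.1.2 - i.1.1) ^ θ

lemma norm_integral_circleChar_mul_vanishProd_le {J : Finset (ℝ × ℝ)} {x₀ θ : ℝ} {P p : ℕ}
    (hJ : ∀ l ∈ J, x₀ ≤ l.1 ∧ l.1 < l.2 ∧ l.2 ≤ x₀ + 2 * Real.pi ∧ l.2 - l.1 ≤ 1)
    (hdisj : ∀ l ∈ J, ∀ l' ∈ J, l ≠ l' → Disjoint (Set.Ioo l.1 l.2) (Set.Ioo l'.1 l'.2))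
    (hθ0 : 0 < θ) (hθ1 : θ < 1)
    (hη4 : ∀ i ∈ J ×ˢ (Finset.univ : Finset Bool), 4 * endpointScale θ i ≤ 1)
    (hP : P * ∑ i ∈ J ×ˢ (Finset.univ : Finset Bool), endpointScale θ i ≤ 1 / 2)
    (hpP : 2 * p + 1 ≤ (1 - θ) * P) {l : ℝ × ℝ} (hl : l ∈ J) (n : ℤ) :
    (1 + |(n : ℝ)| ^ p) * ‖∫ t in l.1..l.2, circleChar n t *
      vanishProd (J ×ˢ Finset.univ) endpoint (endpointScale θ) P (Complex.exp (Complex.I * t))‖ ≤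
      2 * (p.factorial * 32 ^ p * 4 ^ P * Real.exp 1) * (l.2 - l.1) := by
  set C : ℝ := p.factorial * 32 ^ p * 4 ^ P * Real.exp 1 with hC
  have hC1 : 1 ≤ C := by
    have h1 : (1 : ℝ) ≤ p.factorial := by exact_mod_cast Nat.succ_le_of_lt p.factorial_pos
    have h2 : (1 : ℝ) ≤ 32 ^ p := one_le_pow₀ (by norm_num)
    have h3 : (1 : ℝ) ≤ 4 ^ P := one_le_pow₀ (by norm_num)
    have h4 : (1 : ℝ) ≤ Real.exp 1 := Real.one_le_exp zero_le_one
    exact one_le_mul_of_one_le_of_one_le (one_le_mul_of_one_le_of_one_le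
      (one_le_mul_of_one_le_of_one_le h1 h2) h3) h4
  have hη : ∀ i ∈ J ×ˢ (Finset.univ : Finset Bool), 0 < endpointScale θ i := by
    intro i hi
    have := hJ i.1 (Finset.mem_product.mp hi).1
    exact Real.rpow_pos_of_pos (by linarith [this.2.1]) _
  obtain ⟨hl0, hl1, hl2, hl3⟩ := hJ l hl
  set h : ℝ → ℂ := fun t => vanishProd (J ×ˢ Finset.univ) endpoint (endpointScale θ) P
    (Complex.exp (Complex.I * t)) with hh
  have hsmooth : ContDiff ℝ (⊤ : ℕ∞) h :=
    contDiff_comp_ofReal (H := fun τ : ℂ => vanishProd (J ×ˢ Finset.univ) endpoint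
      (endpointScale θ) P (Complex.exp (Complex.I * τ)))
      fun x => analyticAt_vanishProd_exp_ofReal hη x
  have hder : ∀ i ≤ p, ∀ x ∈ Set.Ioo l.1 l.2, ‖iteratedDeriv i h x‖ ≤
      C * min (x - l.1) (l.2 - x) := by
    intro i hi x hx
    have hd : 0 < min (x - l.1) (l.2 - x) := lt_min (by linarith [hx.1]) (by linarith [hx.2])
    have hdl := min_le_left (x - l.1) (l.2 - x)
    have hdr := min_le_right (x - l.1) (l.2 - x)
    set d := min (x - l.1) (l.2 - x) with hdef
    have hηd : ∀ b, d ^ θ ≤ endpointScale θ (l, b) := fun b =>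
      Real.rpow_le_rpow hd.le (by simp only; linarith [hx.1]) hθ0.le
    have hfar : ∀ i ∈ J ×ˢ (Finset.univ : Finset Bool),
        d / 2 ≤ ‖1 - Complex.exp (Complex.I * (x - endpoint i : ℝ))‖ := by
      rintro ⟨l', b⟩ hi
      have hl' := (Finset.mem_product.mp hi).1
      obtain ⟨h0, h1, h2, -⟩ := hJ l' hl'
      have hmem : x₀ ≤ endpoint (l', b) ∧ endpoint (l', b) ≤ x₀ + 2 * Real.pi ∧
          (endpoint (l', b) ≤ l.1 ∨ l.2 ≤ endpoint (l', b)) := by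
        have hout : (l'.1 ≤ l.1 ∨ l.2 ≤ l'.1) ∧ (l'.2 ≤ l.1 ∨ l.2 ≤ l'.2) := by
          by_cases heq : l = l'
          · subst heq; exact ⟨Or.inl le_rfl, Or.inr le_rfl⟩
          · have := hdisj l hl l' hl' heq
            rw [Set.Ioo_disjoint_Ioo] at this
            rcases min_le_iff.mp this with h | h <;> rcases le_max_iff.mp h with h | h
            · exact absurd h hl1.not_ge
            · exact ⟨Or.inr h, Or.inr (h.trans h1.le)⟩
            · exact ⟨Or.inl (h1.le.trans h), Or.inl h⟩
            · exact absurd h h1.not_ge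
        cases b
        · exact ⟨h0.trans h1.le, h2, hout.2⟩
        · exact ⟨h0, h1.le.trans h2, hout.1⟩
      obtain ⟨h3, h4, h5⟩ := hmem
      have hx1 := hx.1
      have hx2 := hx.2
      refine half_le_norm_one_sub_exp ?_ ?_ hd.le
      · rcases h5 with h5 | h5
        · exact le_trans (by linarith) (le_abs_self _)
        · exact le_trans (by linarith) (neg_le_abs _)
      · rcases abs_cases (x - endpoint (l', b)) with h | h <;> rw [h.1] <;> linarith
    obtain ⟨b, hb⟩ : ∃ b, |x - endpoint (l, b)| ≤ d := by
      rcases min_choice (x - l.1) (l.2 - x) with hm | hm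
      · refine ⟨true, ?_⟩
        rw [hdef, hm]
        simp only [endpoint, if_true]
        rw [abs_of_pos (by linarith [hx.1])]
      · refine ⟨false, ?_⟩
        rw [hdef, hm, abs_sub_comm]
        simp only [endpoint, Bool.false_eq_true, if_false]
        rw [abs_of_pos (by linarith [hx.2])]
    exact norm_iteratedDeriv_vanishProd_exp_le hη hη4 hP hθ1 hd (by linarith [hx.1]) hfar
      (i₀ := (l, b)) (Finset.mem_product.mpr ⟨hl, Finset.mem_univ _⟩) hb (hηd b) hpP hi
  have hend : ∀ i < p, circleChar n l.2 * iteratedDeriv i h l.2 =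
      circleChar n l.1 * iteratedDeriv i h l.1 := by
    intro i hi
    have := eq_zero_endpoints_of_le
      (hsmooth.continuous_iteratedDeriv i (by exact_mod_cast le_top)) hl1 (hder i hi.le)
    rw [this.1, this.2, mul_zero, mul_zero]
  have hbig : |(n : ℝ)| ^ p * ‖∫ t in l.1..l.2, circleChar n t * h t‖ ≤ C * (l.2 - l.1) := by
    rw [norm_integral_circleChar_mul_le hsmooth n p hend]
    have := intervalIntegral.norm_integral_le_of_norm_le_const_ae (a := l.1) (b := l.2)
      (f := fun t => circleChar n t * iteratedDeriv p h t) (C := C) ?_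
    · rwa [abs_of_pos (by linarith)] at this
    · filter_upwards [Measure.ae_ne volume l.2] with t ht ht'
      rw [Set.uIoc_of_le hl1.le] at ht'
      rw [norm_mul, norm_circleChar, one_mul]
      refine (hder p le_rfl t ⟨ht'.1, lt_of_le_of_ne ht'.2 ht⟩).trans ?_
      have := min_le_left (t - l.1) (l.2 - t)
      nlinarith [ht'.2]
  have hsmall : ‖∫ t in l.1..l.2, circleChar n t * h t‖ ≤ 1 * |l.2 - l.1| := by
    refine intervalIntegral.norm_integral_le_of_norm_le_const fun t _ => ?_
    rw [norm_mul, norm_circleChar, one_mul]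
    refine norm_vanishProd_le_one hη ?_
    rw [mul_comm, Complex.norm_exp_ofReal_mul_I]
  rw [abs_of_pos (by linarith)] at hsmall
  nlinarith

/-- A compact null set for the `b`-dimensional Hausdorff measure has finite covers by open intervals
whose lengths have arbitrarily small sum of `b`-th powers. -/
lemma exists_interval_cover {K : Set ℝ} (hK : IsCompact K) {x₀ x₁ b ε : ℝ}
    (hKI : K ⊆ Set.Ioo x₀ x₁) (hb0 : 0 < b) (hb1 : b ≤ 1)
    (hμ : Measure.hausdorffMeasure b K = 0) (hε : 0 < ε) :
    ∃ J : Finset (ℝ × ℝ), (∀ l ∈ J, x₀ ≤ l.1 ∧ l.1 < l.2 ∧ l.2 ≤ x₁) ∧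
      (K ⊆ ⋃ l ∈ J, Set.Ioo l.1 l.2) ∧ ∑ l ∈ J, (l.2 - l.1) ^ b < ε := by
  classical
  have hε4 : (0 : ENNReal) < ENNReal.ofReal (ε / 4) := by
    rw [ENNReal.ofReal_pos]; linarith
  obtain ⟨t, ht, ht1, hts⟩ : ∃ t : ℕ → Set ℝ, K ⊆ ⋃ n, t n ∧ (∀ n, Metric.ediam (t n) ≤ 1) ∧
      ∑' n, ⨆ (_ : (t n).Nonempty), Metric.ediam (t n) ^ b < ENNReal.ofReal (ε / 4) := by
    rw [Measure.hausdorffMeasure_apply] at hμ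
    have h1 := lt_of_le_of_lt ((le_iSup₂ (f := fun (r : ENNReal) (_ : 0 < r) =>
      ⨅ (t : ℕ → Set ℝ) (_ : K ⊆ ⋃ n, t n) (_ : ∀ n : ℕ, Metric.ediam (t n) ≤ r),
        ∑' n : ℕ, ⨆ (_ : (t n).Nonempty), Metric.ediam (t n) ^ b) 1 one_pos).trans hμ.le) hε4
    simp only [iInf_lt_iff] at h1
    obtain ⟨t, h1, h2, h3⟩ := h1
    exact ⟨t, h1, h2, h3⟩
  obtain ⟨ε', hε'0, hε's⟩ := ENNReal.exists_pos_sum_of_countable hε4.ne' ℕ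
  have hc : ∀ n, ∃ c, (K ∩ t n).Nonempty → c ∈ K ∩ t n := by
    intro n
    by_cases h : (K ∩ t n).Nonempty
    · exact ⟨h.some, fun _ => h.some_mem⟩
    · exact ⟨0, fun h' => absurd h' h⟩
  choose c hc using hc
  set δ : ℕ → ℝ := fun n => (Metric.ediam (t n)).toReal with hδ
  have htop : ∀ n, Metric.ediam (t n) ≠ ⊤ := fun n => ((ht1 n).trans_lt ENNReal.one_lt_top).ne
  set ρ : ℕ → ℝ := fun n => (δ n ^ b + ε' n) ^ (1 / b) with hρ
  have hδ0 : ∀ n, 0 ≤ δ n := fun n => ENNReal.toReal_nonneg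
  have hε0 : ∀ n, (0 : ℝ) < ε' n := fun n => by exact_mod_cast hε'0 n
  have hρδ : ∀ n, δ n < ρ n := by
    intro n
    calc δ n = (δ n ^ b) ^ (1 / b) := by
          rw [← Real.rpow_mul (hδ0 n), mul_one_div_cancel hb0.ne', Real.rpow_one]
      _ < _ := Real.rpow_lt_rpow (Real.rpow_nonneg (hδ0 n) _) (by linarith [hε0 n]) (by positivity)
  have hρ0 : ∀ n, 0 < ρ n := fun n => (hδ0 n).trans_lt (hρδ n)
  have hρb : ∀ n, ρ n ^ b = δ n ^ b + ε' n := by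
    intro n
    have : 0 ≤ δ n ^ b + ε' n := add_nonneg (Real.rpow_nonneg (hδ0 n) _) (hε0 n).le
    rw [hρ]
    simp only
    rw [← Real.rpow_mul this, one_div_mul_cancel hb0.ne', Real.rpow_one]
  set N : Set ℕ := {n | (K ∩ t n).Nonempty}
  set I : ℕ → ℝ × ℝ := fun n => (max x₀ (c n - ρ n), min x₁ (c n + ρ n)) with hI
  obtain ⟨T, hTN, hTf, hT⟩ := hK.elim_finite_subcover_image (b := N)
    (c := fun n => Set.Ioo (I n).1 (I n).2) (fun _ _ => isOpen_Ioo) (by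
      intro x hx
      obtain ⟨n, hn⟩ := Set.mem_iUnion.mp (ht hx)
      have hnN : n ∈ N := ⟨x, hx, hn⟩
      refine Set.mem_iUnion₂.mpr ⟨n, hnN, ?_⟩
      have hd : |x - c n| ≤ δ n := by
        have h1 := Metric.edist_le_ediam_of_mem hn (hc n hnN).2
        rw [edist_dist] at h1
        have := ENNReal.toReal_mono (htop n) h1
        rwa [ENNReal.toReal_ofReal dist_nonneg, Real.dist_eq] at this
      have h2 := abs_le.mp hd
      have h3 := hKI hx
      exact ⟨max_lt h3.1 (by linarith [hρδ n]), lt_min h3.2 (by linarith [hρδ n])⟩)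
  have hlt : ∀ n ∈ N, (I n).1 < (I n).2 := by
    intro n hn
    have h3 := hKI (hc n hn).1
    have := hρ0 n
    exact max_lt (lt_min (h3.1.trans h3.2) (by linarith [h3.1]))
      (lt_min (by linarith [h3.2]) (by linarith))
  refine ⟨hTf.toFinset.image I, ?_, ?_, ?_⟩
  · intro l hl
    obtain ⟨n, hn, rfl⟩ := Finset.mem_image.mp hl
    rw [Set.Finite.mem_toFinset] at hn
    exact ⟨le_max_left _ _, hlt n (hTN hn), min_le_left _ _⟩
  · intro x hx
    obtain ⟨n, hn, hxn⟩ := Set.mem_iUnion₂.mp (hT hx)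
    exact Set.mem_iUnion₂.mpr ⟨I n, Finset.mem_image_of_mem _ (hTf.mem_toFinset.mpr hn), hxn⟩
  · have hterm : ∀ n ∈ hTf.toFinset, ((I n).2 - (I n).1) ^ b ≤ 2 * (δ n ^ b + ε' n) := by
      intro n hn
      have hn' := hlt n (hTN (hTf.mem_toFinset.mp hn))
      have h1 : (I n).2 - (I n).1 ≤ 2 * ρ n := by
        have := le_max_right x₀ (c n - ρ n)
        have := min_le_right x₁ (c n + ρ n)
        simp only [hI]; linarith
      calc ((I n).2 - (I n).1) ^ b ≤ (2 * ρ n) ^ b :=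
            Real.rpow_le_rpow (by linarith) h1 hb0.le
        _ = 2 ^ b * ρ n ^ b := Real.mul_rpow (by norm_num) (hρ0 n).le
        _ ≤ 2 ^ (1 : ℝ) * ρ n ^ b := by
            have := hρ0 n
            gcongr
            norm_num
        _ = _ := by rw [Real.rpow_one, hρb]
    have hsum1 : ∑ n ∈ hTf.toFinset, δ n ^ b < ε / 4 := by
      rw [← ENNReal.ofReal_lt_ofReal_iff (by linarith),
        ENNReal.ofReal_sum_of_nonneg fun n _ => Real.rpow_nonneg (hδ0 n) _]
      refine lt_of_le_of_lt ?_ hts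
      refine le_trans (Finset.sum_le_sum fun n hn => ?_) (ENNReal.sum_le_tsum hTf.toFinset)
      rw [iSup_pos ((hTN (hTf.mem_toFinset.mp hn)).mono Set.inter_subset_right),
        ← ENNReal.ofReal_rpow_of_nonneg (hδ0 n) hb0.le, ENNReal.ofReal_toReal (htop n)]
    have hsum2 : ∑ n ∈ hTf.toFinset, (ε' n : ℝ) < ε / 4 := by
      rw [← ENNReal.ofReal_lt_ofReal_iff (by linarith),
        ENNReal.ofReal_sum_of_nonneg fun n _ => (hε0 n).le]
      refine lt_of_le_of_lt ?_ hε's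
      refine le_trans (Finset.sum_le_sum fun n hn => ?_) (ENNReal.sum_le_tsum hTf.toFinset)
      rw [ENNReal.ofReal_coe_nnreal]
    calc _ ≤ ∑ n ∈ hTf.toFinset, ((I n).2 - (I n).1) ^ b := by
          refine Finset.sum_image_le_of_nonneg (f := fun l : ℝ × ℝ => (l.2 - l.1) ^ b) ?_
          intro l hl
          obtain ⟨n, hn, rfl⟩ := Finset.mem_image.mp hl
          have := hlt n (hTN (hTf.mem_toFinset.mp hn))
          exact Real.rpow_nonneg (by linarith) _
      _ ≤ ∑ n ∈ hTf.toFinset, 2 * (δ n ^ b + ε' n) := Finset.sum_le_sum hterm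
      _ = 2 * (∑ n ∈ hTf.toFinset, δ n ^ b + ∑ n ∈ hTf.toFinset, (ε' n : ℝ)) := by
          rw [← Finset.mul_sum, Finset.sum_add_distrib]
      _ < ε := by linarith

lemma exists_disjoint_interval_cover {K : Set ℝ} (hK : IsCompact K) {x₀ x₁ b ε : ℝ}
    (hKI : K ⊆ Set.Ioo x₀ x₁) (hb0 : 0 < b) (hb1 : b ≤ 1)
    (hμ : Measure.hausdorffMeasure b K = 0) (hε : 0 < ε) :
    ∃ J : Finset (ℝ × ℝ), (∀ l ∈ J, x₀ ≤ l.1 ∧ l.1 < l.2 ∧ l.2 ≤ x₁) ∧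
      (K ⊆ ⋃ l ∈ J, Set.Ioo l.1 l.2) ∧ ∑ l ∈ J, (l.2 - l.1) ^ b < ε ∧
      ∀ l ∈ J, ∀ l' ∈ J, l ≠ l' → Disjoint (Set.Ioo l.1 l.2) (Set.Ioo l'.1 l'.2) := by
  classical
  obtain ⟨J, ⟨hJ1, hJ2, hJ3⟩, hmin⟩ := exists_minimalFor_of_wellFoundedLT
    (fun J : Finset (ℝ × ℝ) => (∀ l ∈ J, x₀ ≤ l.1 ∧ l.1 < l.2 ∧ l.2 ≤ x₁) ∧
      (K ⊆ ⋃ l ∈ J, Set.Ioo l.1 l.2) ∧ ∑ l ∈ J, (l.2 - l.1) ^ b < ε) Finset.card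
    (exists_interval_cover hK hKI hb0 hb1 hμ hε)
  refine ⟨J, hJ1, hJ2, hJ3, fun l hl l' hl' hne => ?_⟩
  by_contra hdis
  rw [Set.Ioo_disjoint_Ioo, not_le] at hdis
  obtain ⟨h0, h1, h2⟩ := hJ1 l hl
  obtain ⟨h0', h1', h2'⟩ := hJ1 l' hl'
  have hml' : l' ∈ J.erase l := Finset.mem_erase.mpr ⟨hne.symm, hl'⟩
  set m : ℝ × ℝ := (min l.1 l'.1, max l.2 l'.2) with hm
  have hm0 : 0 < m.2 - m.1 := by
    have := min_le_left l.1 l'.1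
    have := le_max_left l.2 l'.2
    simp only [hm]; linarith
  have hmle : m.2 - m.1 ≤ (l.2 - l.1) + (l'.2 - l'.1) := by
    have e1 := min_add_max l.1 l'.1
    have e2 := min_add_max l.2 l'.2
    simp only [hm]; linarith
  have hcard : (insert m ((J.erase l).erase l')).card < J.card := by
    have h3 := Finset.card_insert_le m ((J.erase l).erase l')
    have h4 := Finset.card_erase_add_one hml'
    have h5 := Finset.card_erase_add_one hl
    omega
  refine absurd (hmin (j := insert m ((J.erase l).erase l')) ⟨?_, ?_, ?_⟩ hcard.le) hcard.not_ge
  · intro i hi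
    rcases Finset.mem_insert.mp hi with rfl | hi
    · exact ⟨le_min h0 h0', by linarith, max_le h2 h2'⟩
    · exact hJ1 i (Finset.mem_of_mem_erase (Finset.mem_of_mem_erase hi))
  · intro x hx
    obtain ⟨i, hi, hxi⟩ := Set.mem_iUnion₂.mp (hJ2 hx)
    by_cases hil : i = l
    · subst hil
      exact Set.mem_iUnion₂.mpr ⟨m, Finset.mem_insert_self _ _,
        (min_le_left _ _).trans_lt hxi.1, hxi.2.trans_le (le_max_left _ _)⟩
    by_cases hil' : i = l'
    · subst hil'
      exact Set.mem_iUnion₂.mpr ⟨m, Finset.mem_insert_self _ _,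
        (min_le_right _ _).trans_lt hxi.1, hxi.2.trans_le (le_max_right _ _)⟩
    exact Set.mem_iUnion₂.mpr ⟨i, Finset.mem_insert_of_mem
      (Finset.mem_erase.mpr ⟨hil', Finset.mem_erase.mpr ⟨hil, hi⟩⟩), hxi⟩
  · refine lt_of_le_of_lt ?_ hJ3
    rw [← Finset.add_sum_erase J _ hl, ← Finset.add_sum_erase (J.erase l) _ hml', ← add_assoc]
    have hins : ∑ i ∈ insert m ((J.erase l).erase l'), (i.2 - i.1) ^ b ≤
        (m.2 - m.1) ^ b + ∑ i ∈ (J.erase l).erase l', (i.2 - i.1) ^ b := by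
      by_cases hmem : m ∈ (J.erase l).erase l'
      · rw [Finset.insert_eq_of_mem hmem]
        linarith [Real.rpow_nonneg hm0.le b]
      · rw [Finset.sum_insert hmem]
    refine hins.trans ?_
    gcongr
    refine (Real.rpow_le_rpow hm0.le hmle hb0.le).trans ?_
    exact Real.rpow_add_le_add_rpow (by linarith) (by linarith) hb0.le hb1

/-- The `2π`-periodization of a set. -/
def periodization (K : Set ℝ) : Set ℝ := ⋃ m : ℤ, (fun t => t + 2 * Real.pi * m) '' K

lemma isClosed_periodization {K : Set ℝ} (hK : IsCompact K) : IsClosed (periodization K) := by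
  have h1 : periodization K =
      ((↑) : ℝ → AddCircle (2 * Real.pi)) ⁻¹' (((↑) : ℝ → AddCircle (2 * Real.pi)) '' K) := by
    ext x
    simp only [periodization, Set.mem_iUnion, Set.mem_image, Set.mem_preimage]
    constructor
    · rintro ⟨m, t, ht, rfl⟩
      refine ⟨t, ht, ?_⟩
      have : ((2 * Real.pi * m : ℝ) : AddCircle (2 * Real.pi)) = 0 :=
        (AddCircle.coe_eq_zero_iff _).mpr ⟨m, by rw [zsmul_eq_mul, mul_comm]⟩
      rw [AddCircle.coe_add, this, add_zero]
    · rintro ⟨t, ht, hx⟩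
      have : ((x - t : ℝ) : AddCircle (2 * Real.pi)) = 0 := by
        rw [AddCircle.coe_sub, hx, sub_self]
      obtain ⟨m, hm⟩ := (AddCircle.coe_eq_zero_iff _).mp this
      refine ⟨m, t, ht, ?_⟩
      rw [zsmul_eq_mul] at hm
      linarith
  rw [h1]
  exact ((hK.image (AddCircle.continuous_mk' _)).isClosed).preimage (AddCircle.continuous_mk' _)

lemma dimH_periodization_le (K : Set ℝ) : dimH (periodization K) ≤ dimH K := by
  unfold periodization
  rw [dimH_iUnion]
  exact iSup_le fun m => ((isometry_add_right (2 * Real.pi * (m : ℝ))).dimH_image K).le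

lemma add_two_pi_mem_periodization {K : Set ℝ} {x : ℝ} :
    x + 2 * Real.pi ∈ periodization K ↔ x ∈ periodization K := by
  simp only [periodization, Set.mem_iUnion, Set.mem_image]
  constructor
  · rintro ⟨m, t, ht, h⟩
    exact ⟨m - 1, t, ht, by push_cast; linarith⟩
  · rintro ⟨m, t, ht, h⟩
    exact ⟨m + 1, t, ht, by push_cast; linarith⟩

lemma fourierCoeffPeriodic_cosBump (c x : ℝ) (m : ℤ) :
    fourierCoeffPeriodic (fun t => (cosBump c (t - x) : ℂ)) (-m) =
      (1 / (2 * Real.pi)) • (cosBumpCoeff c m * circleChar m x) := by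
  unfold fourierCoeffPeriodic
  congr 1
  have h1 : ∀ t : ℝ, Complex.exp (-Complex.I * ((-m : ℤ) : ℂ) * t) * (cosBump c (t - x) : ℂ) =
      circleChar m x * (circleChar m (t - x) * cosBump c (t - x)) := by
    intro t
    rw [← mul_assoc, circleChar, circleChar, ← Complex.exp_add]
    congr 2
    push_cast; ring
  simp_rw [h1]
  rw [intervalIntegral.integral_const_mul, intervalIntegral.integral_comp_sub_right
    (fun t => circleChar m t * (cosBump c t : ℂ)), mul_comm, cosBumpCoeff]
  congr 1
  have hper : Function.Periodic (fun t => circleChar m t * (cosBump c t : ℂ)) (2 * Real.pi) := by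
    intro t
    simp only [circleChar_periodic m t, cosBump_periodic c t]
  have := hper.intervalIntegral_add_eq (0 - x) 0
  rw [zero_add] at this
  rw [← this]
  congr 1
  ring

lemma DistribSupportedIn.tsum_cosBumpCoeff_eq_zero {a : ℤ → ℂ} {K : Set ℝ}
    (h : DistribSupportedIn a K) {c x : ℝ} (hx : ∀ t ∈ periodization K, Real.cos (t - x) < c) :
    ∑' m : ℤ, a m * cosBumpCoeff c m * circleChar m x = 0 := by
  have h1 := h (fun t => (cosBump c (t - x) : ℂ))
    (Complex.ofRealCLM.contDiff.comp ((contDiff_cosBump c).comp (contDiff_id.sub contDiff_const)))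
    (fun t => by
      simp only
      rw [add_sub_right_comm, cosBump_periodic])
    ⟨{t | Real.cos (t - x) < c}, isOpen_lt (by fun_prop) continuous_const, hx, fun t ht => by
      rw [cosBump_eq_zero (le_of_lt ht), Complex.ofReal_zero]⟩
  simp_rw [fourierCoeffPeriodic_cosBump, mul_smul_comm, ← mul_assoc] at h1
  rw [tsum_const_smul''] at h1
  exact (smul_eq_zero.mp h1).resolve_left (by positivity)

lemma HasPolyGrowth.exists_summable {a : ℤ → ℂ} (ha : HasPolyGrowth a) :
    ∃ p : ℕ, ∀ k : ℤ, Summable fun m : ℤ => ‖a m‖ * (1 + |((m - k : ℤ) : ℝ)| ^ p)⁻¹ := by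
  obtain ⟨C, κ, hC⟩ := ha
  set q := ⌈κ⌉₊
  refine ⟨q + 2, fun k => ?_⟩
  have hbase : Summable fun m : ℤ => ((1 : ℝ) + |(m : ℝ)|) ^ (-2 : ℝ) := by
    have hs : Summable fun n : ℕ => ((1 : ℝ) + |(n : ℝ)|) ^ (-2 : ℝ) := by
      have := (summable_nat_add_iff 1).mpr (Real.summable_nat_rpow (p := -2) |>.mpr (by norm_num))
      refine this.congr fun n => ?_
      rw [Nat.abs_cast]; push_cast; rw [add_comm]
    refine Summable.of_nat_of_neg ?_ ?_
    · simpa using hs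
    · simpa using hs
  have hshift : Summable fun m : ℤ => ((1 : ℝ) + |((m - k : ℤ) : ℝ)|) ^ (-2 : ℝ) :=
    (Equiv.subRight k).summable_iff.mpr hbase
  refine Summable.of_nonneg_of_le (fun m => by positivity) (fun m => ?_)
    (hshift.mul_left (|C| * (1 + |(k : ℝ)|) ^ q * 2 ^ (q + 2)))
  set y : ℝ := |((m - k : ℤ) : ℝ)| with hy
  have hy0 : 0 ≤ y := abs_nonneg _
  have hk0 : 0 ≤ |(k : ℝ)| := abs_nonneg _
  have h1 : ‖a m‖ ≤ |C| * ((1 + |(k : ℝ)|) ^ q * (1 + y) ^ q) := by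
    have hm : 1 + |(m : ℝ)| ≤ (1 + |(k : ℝ)|) * (1 + y) := by
      have : |(m : ℝ)| ≤ y + |(k : ℝ)| := by
        rw [hy]; push_cast
        simpa using abs_add_le ((m : ℝ) - k) k
      nlinarith
    calc ‖a m‖ ≤ C * (1 + |(m : ℝ)|) ^ κ := hC m
      _ ≤ |C| * (1 + |(m : ℝ)|) ^ (q : ℝ) := by
          gcongr
          · exact le_abs_self C
          · linarith [abs_nonneg (m : ℝ)]
          · exact Nat.le_ceil κ
      _ ≤ |C| * ((1 + |(k : ℝ)|) * (1 + y)) ^ q := by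
          rw [Real.rpow_natCast]; gcongr
      _ = _ := by rw [mul_pow]
  have h2 : (1 + y) ^ (q + 2) ≤ 2 ^ (q + 2) * (1 + y ^ (q + 2)) := by
    refine (add_pow_le zero_le_one hy0 (q + 2)).trans ?_
    rw [one_pow]
    gcongr <;> norm_num
  have h3 : (0 : ℝ) < 1 + y ^ (q + 2) := by positivity
  rw [Real.rpow_neg (by positivity), ← div_eq_mul_inv, ← div_eq_mul_inv, Real.rpow_two,
    div_le_div_iff₀ h3 (by positivity)]
  calc ‖a m‖ * (1 + y) ^ 2
      ≤ |C| * ((1 + |(k : ℝ)|) ^ q * (1 + y) ^ q) * (1 + y) ^ 2 := by gcongr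
    _ = |C| * (1 + |(k : ℝ)|) ^ q * (1 + y) ^ (q + 2) := by ring
    _ ≤ |C| * (1 + |(k : ℝ)|) ^ q * (2 ^ (q + 2) * (1 + y ^ (q + 2))) := by gcongr
    _ = _ := by ring

lemma HasPolyGrowth.summable_norm_mul_cosBumpCoeff {a : ℤ → ℂ} (ha : HasPolyGrowth a) (c : ℝ) :
    Summable fun m => ‖a m * cosBumpCoeff c m‖ := by
  obtain ⟨p, hp⟩ := ha.exists_summable
  obtain ⟨C, hC⟩ := norm_integral_le_of_periodic (h := fun t => (cosBump c t : ℂ))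
    (Complex.ofRealCLM.contDiff.comp (contDiff_cosBump c))
    (fun t => by simp only [cosBump_periodic c t]) p
  have h0 := hp 0
  simp only [sub_zero] at h0
  refine Summable.of_nonneg_of_le (fun m => norm_nonneg _) (fun m => ?_)
    (h0.mul_right ((∫ t in (0 : ℝ)..(2 * Real.pi), cosBump c t) + C))
  have h1 := hC m
  have h2 := norm_cosBumpCoeff_le c m
  rw [norm_mul, mul_assoc]
  gcongr
  rw [inv_mul_eq_div, le_div_iff₀ (by positivity), mul_comm, add_mul, one_mul]
  exact add_le_add h2 h1

lemma summable_sq_shift {a : ℤ → ℂ} {α : ℝ} (hα1 : α ≤ 1)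
    (hsum : Summable fun n : ℕ => ‖a (-(n + 1 : ℕ))‖ ^ 2 / ((n + 1 : ℝ)) ^ (1 - α)) (k : ℤ) :
    Summable fun j : ℕ => ‖a (k - (j + 1 : ℕ))‖ ^ 2 / ((j + 1 : ℕ) : ℝ) ^ (1 - α) := by
  rw [← summable_nat_add_iff k.toNat]
  have hs := (summable_nat_add_iff (-k).toNat).mpr hsum
  refine Summable.of_nonneg_of_le (fun j => by positivity) (fun j => ?_)
    (hs.mul_right (((-k).toNat + 1 : ℝ) ^ (1 - α)))
  have hidx : k - ((j + k.toNat + 1 : ℕ) : ℤ) = -((j + (-k).toNat + 1 : ℕ) : ℤ) := by omega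
  rw [hidx, div_mul_eq_mul_div, div_le_div_iff₀ (by positivity) (by positivity), mul_assoc,
    ← Real.mul_rpow (by positivity) (by positivity)]
  gcongr
  push_cast
  have h1 : (0 : ℝ) ≤ j := Nat.cast_nonneg _
  have h2 : (0 : ℝ) ≤ (-k).toNat := Nat.cast_nonneg _
  have h3 : (0 : ℝ) ≤ k.toNat := Nat.cast_nonneg _
  nlinarith [mul_nonneg h1 h2, mul_nonneg h2 h3]

lemma integral_eq_sum_of_eq_zero {F : ℝ → ℂ} (hF : Continuous F) {J : Finset (ℝ × ℝ)} {x₀ x₁ : ℝ}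
    (hx : x₀ ≤ x₁) (hJ : ∀ l ∈ J, x₀ ≤ l.1 ∧ l.1 < l.2 ∧ l.2 ≤ x₁)
    (hdisj : ∀ l ∈ J, ∀ l' ∈ J, l ≠ l' → Disjoint (Set.Ioo l.1 l.2) (Set.Ioo l'.1 l'.2))
    (hz : ∀ x ∈ Set.Icc x₀ x₁, x ∉ ⋃ l ∈ J, Set.Ioo l.1 l.2 → F x = 0) :
    ∫ t in x₀..x₁, F t = ∑ l ∈ J, ∫ t in l.1..l.2, F t := by
  rw [intervalIntegral.integral_of_le hx,
    setIntegral_eq_of_subset_of_forall_sdiff_eq_zero (s := ⋃ l ∈ J, Set.Ioo l.1 l.2)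
      measurableSet_Ioc, integral_biUnion_finset]
  · refine Finset.sum_congr rfl fun l hl => ?_
    rw [intervalIntegral.integral_of_le (hJ l hl).2.1.le, integral_Ioc_eq_integral_Ioo]
  · exact fun _ _ => measurableSet_Ioo
  · exact fun l hl l' hl' hne => hdisj l hl l' hl' hne
  · exact fun l _ => (hF.integrableOn_Icc (a := l.1) (b := l.2)).mono_set Set.Ioo_subset_Icc_self
  · refine Set.iUnion₂_subset fun l hl y hy => ?_
    have := hJ l hl
    exact ⟨this.1.trans_lt hy.1, hy.2.le.trans this.2.2⟩
  · exact fun x hx' => hz x (Set.Ioc_subset_Icc_self hx'.1) hx'.2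

lemma norm_sub_le_of_hasSum {f : ℕ → ℂ} {S : ℂ} (hf : HasSum f S) {B : ℝ}
    (hB : ∀ T : Finset ℕ, ∑ j ∈ T, ‖f (j + 1)‖ ≤ B) : ‖f 0‖ ≤ ‖S‖ + B := by
  have h1 := (hasSum_nat_add_iff' 1).mpr hf
  rw [Finset.sum_range_one] at h1
  have h2 : ‖S - f 0‖ ≤ B :=
    le_of_tendsto h1.norm (Eventually.of_forall fun T => (norm_sum_le _ _).trans (hB T))
  have h3 := norm_sub_norm_le (f 0) S
  rw [norm_sub_rev] at h3
  linarith

lemma exists_cos_sub_lt {K X : Set ℝ} (hK : IsCompact K) (hX : IsCompact X)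
    (h : ∀ x ∈ X, x ∉ periodization K) {c₀ : ℝ} (hc₀ : c₀ < 1) :
    ∃ c, c₀ ≤ c ∧ c < 1 ∧ ∀ x ∈ X, ∀ t ∈ periodization K, Real.cos (t - x) < c := by
  have key : ∃ M < 1, ∀ x ∈ X, ∀ t ∈ K, Real.cos (t - x) ≤ M := by
    rcases (K ×ˢ X).eq_empty_or_nonempty with he | hne
    · exact ⟨0, one_pos, fun x hx t ht => absurd (Set.mk_mem_prod ht hx) (he ▸ Set.notMem_empty _)⟩
    · obtain ⟨⟨t₁, x₁⟩, hmem, hmax⟩ := (hK.prod hX).exists_isMaxOn hne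
        (f := fun y : ℝ × ℝ => Real.cos (y.1 - y.2)) (by fun_prop)
      refine ⟨Real.cos (t₁ - x₁), lt_of_le_of_ne (Real.cos_le_one _) fun h1 => ?_,
        fun x hx t ht => hmax (Set.mk_mem_prod ht hx)⟩
      obtain ⟨m, hm⟩ := (Real.cos_eq_one_iff _).mp h1
      refine h x₁ hmem.2 (Set.mem_iUnion.mpr ⟨-m, t₁, hmem.1, ?_⟩)
      push_cast
      linarith
  obtain ⟨M, hM1, hM⟩ := key
  refine ⟨max c₀ ((M + 1) / 2), le_max_left _ _, max_lt hc₀ (by linarith), fun x hx t ht => ?_⟩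
  obtain ⟨m, t', ht', rfl⟩ := Set.mem_iUnion.mp ht
  have h1 : t' + 2 * Real.pi * m - x = t' - x + m * (2 * Real.pi) := by ring
  simp only
  rw [h1, Real.cos_add_int_mul_two_pi]
  exact lt_of_le_of_lt (hM x hx t' ht') (lt_max_of_lt_right (by linarith))

/-- Quantitative form of the theorem: an efficient cover of `K` by disjoint intervals forces the
Fourier coefficients to be small. -/
lemma norm_le_of_cover {a : ℤ → ℂ} (ha : HasPolyGrowth a) {K : Set ℝ} (hK : IsCompact K)
    (hsupp : DistribSupportedIn a K) {x₀ α β b C ε : ℝ} {p P : ℕ} {k : ℤ} {J : Finset (ℝ × ℝ)}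
    (hsum : Summable fun j : ℕ => ‖a (k - (j + 1 : ℕ))‖ ^ 2 / ((j + 1 : ℕ) : ℝ) ^ (1 - α))
    (hp : Summable fun m : ℤ => ‖a m‖ * (1 + |((m - k : ℤ) : ℝ)| ^ p)⁻¹)
    (hb0 : 0 < b) (hbβ : b < β) (hβ1 : β < 1) (hpP : 2 * p + 1 ≤ (1 - b / β) * P)
    (hC0 : 0 ≤ C)
    (hC : ∀ (G : ℂ → ℂ) (R B : ℝ), 1 < R → DifferentiableOn ℂ G (Metric.ball 0 R) →
      (∀ z, ‖z‖ ≤ 1 → ‖G z‖ ≤ 1) → 0 ≤ B →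
      (∀ r : ℝ, 0 ≤ r → r < 1 → ∫ t in (0 : ℝ)..(0 + 2 * Real.pi),
        ‖deriv G (r * Complex.exp (Complex.I * t))‖ ≤ B * (1 - r) ^ (-β)) →
      ∀ T : Finset ℕ, ∑ j ∈ T, ((j + 1 : ℕ) : ℝ) ^ (1 - α) * ‖taylorCoeff G (j + 1)‖ ^ 2 ≤
        C * B)
    (hε : 0 < ε) (hεP : 8 * (P + 1) * ε ≤ 1)
    (hJ : ∀ l ∈ J, x₀ ≤ l.1 ∧ l.1 < l.2 ∧ l.2 ≤ x₀ + 2 * Real.pi)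
    (hdisj : ∀ l ∈ J, ∀ l' ∈ J, l ≠ l' → Disjoint (Set.Ioo l.1 l.2) (Set.Ioo l'.1 l'.2))
    (hcover : periodization K ∩ Set.Icc x₀ (x₀ + 2 * Real.pi) ⊆ ⋃ l ∈ J, Set.Ioo l.1 l.2)
    (hJε : ∑ l ∈ J, (l.2 - l.1) ^ b < ε) :
    ‖a k‖ * (Real.pi / 2) ≤
      2 * (p.factorial * 32 ^ p * 4 ^ P * Real.exp 1) *
        (∑' m : ℤ, ‖a m‖ * (1 + |((m - k : ℤ) : ℝ)| ^ p)⁻¹) * ε +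
      2 * Real.pi * (√(∑' j : ℕ, ‖a (k - (j + 1 : ℕ))‖ ^ 2 / ((j + 1 : ℕ) : ℝ) ^ (1 - α)) *
        √(C * (4 * Real.pi * P * ε))) := by
  have hpi := Real.pi_pos
  have hβ0 : 0 < β := hb0.trans hbβ
  set θ : ℝ := b / β with hθ
  have hθ0 : 0 < θ := by positivity
  have hθ1 : θ < 1 := (div_lt_one hβ0).mpr hbβ
  have hP0 : (0 : ℝ) ≤ P := Nat.cast_nonneg _
  have hε8 : 8 * ε ≤ 1 := by nlinarith
  have hpos : ∀ l ∈ J, 0 < l.2 - l.1 := fun l hl => by linarith [(hJ l hl).2.1]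
  have hle : ∀ l ∈ J, (l.2 - l.1) ^ b ≤ ε := fun l hl =>
    (Finset.single_le_sum (f := fun l : ℝ × ℝ => (l.2 - l.1) ^ b)
      (fun i hi => Real.rpow_nonneg (hpos i hi).le _) hl).trans hJε.le
  have hle1 : ∀ l ∈ J, l.2 - l.1 ≤ 1 := by
    intro l hl
    by_contra! h
    linarith [hle l hl, Real.one_le_rpow h.le hb0.le]
  set s : Finset ((ℝ × ℝ) × Bool) := J ×ˢ Finset.univ with hs
  set η : (ℝ × ℝ) × Bool → ℝ := endpointScale θ with hηdef
  have hη : ∀ i ∈ s, 0 < η i := fun i hi =>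
    Real.rpow_pos_of_pos (hpos i.1 (Finset.mem_product.mp hi).1) _
  have hη1 : ∀ i ∈ s, η i ≤ 1 := fun i hi =>
    Real.rpow_le_one (hpos i.1 (Finset.mem_product.mp hi).1).le
      (hle1 i.1 (Finset.mem_product.mp hi).1) hθ0.le
  have hηβ : ∀ i ∈ s, η i ^ β = (i.1.2 - i.1.1) ^ b := by
    intro i hi
    rw [hηdef, endpointScale, ← Real.rpow_mul (hpos i.1 (Finset.mem_product.mp hi).1).le, hθ,
      div_mul_cancel₀ _ hβ0.ne']
  have hηle : ∀ i ∈ s, η i ≤ η i ^ β := fun i hi => by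
    simpa using Real.rpow_le_rpow_of_exponent_ge (hη i hi) (hη1 i hi) hβ1.le
  have hη4 : ∀ i ∈ s, 4 * η i ≤ 1 := by
    intro i hi
    have := hηle i hi
    rw [hηβ i hi] at this
    linarith [hle i.1 (Finset.mem_product.mp hi).1]
  have hsumβ : ∑ i ∈ s, η i ^ β ≤ 2 * ε := by
    rw [Finset.sum_congr rfl hηβ, hs, Finset.sum_product]
    simp only [Fintype.sum_bool, ← two_mul, ← Finset.mul_sum]
    linarith
  have hPη : P * ∑ i ∈ s, η i ≤ 1 / 2 := by
    have := mul_le_mul_of_nonneg_left ((Finset.sum_le_sum hηle).trans hsumβ) hP0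
    linarith
  set G := vanishProd s endpoint η P with hG
  obtain ⟨R, hR1, hR⟩ : ∃ R, 1 < R ∧ ∀ i ∈ s, R ≤ 1 + η i := by
    rcases s.eq_empty_or_nonempty with he | hne
    · exact ⟨2, one_lt_two, by simp [he]⟩
    · obtain ⟨i, hi, hmin⟩ := s.exists_min_image η hne
      exact ⟨1 + η i, by linarith [hη i hi], fun j hj => by linarith [hmin j hj]⟩
  have hGd : DifferentiableOn ℂ G (Metric.ball 0 R) := differentiableOn_vanishProd hη hR
  have hG1 : ∀ z, ‖z‖ ≤ 1 → ‖G z‖ ≤ 1 := fun z hz => norm_vanishProd_le_one hη hz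
  have hsq : ∀ T : Finset ℕ, ∑ j ∈ T, ((j + 1 : ℕ) : ℝ) ^ (1 - α) * ‖taylorCoeff G (j + 1)‖ ^ 2 ≤
      C * (4 * Real.pi * P * ε) := by
    intro T
    refine (hC G R (2 * Real.pi * P * ∑ i ∈ s, η i ^ β) hR1 hGd hG1 ?_ ?_ T).trans ?_
    · exact mul_nonneg (by positivity)
        (Finset.sum_nonneg fun i hi => Real.rpow_nonneg (hη i hi).le _)
    · exact fun r hr0 hr => integral_norm_deriv_vanishProd_le hη hβ0 hβ1 hr0 hr
    · calc C * (2 * Real.pi * P * ∑ i ∈ s, η i ^ β) ≤ C * (2 * Real.pi * P * (2 * ε)) := by gcongr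
        _ = _ := by ring
  set X : Set ℝ := Set.Icc x₀ (x₀ + 2 * Real.pi) \ ⋃ l ∈ J, Set.Ioo l.1 l.2
  have hXc : IsCompact X :=
    isCompact_Icc.diff (isOpen_biUnion fun _ _ => isOpen_Ioo)
  obtain ⟨c, hc0, hc1, hc⟩ := exists_cos_sub_lt hK hXc
    (fun x hx hxK => hx.2 (hcover ⟨hxK, hx.1⟩))
    (c₀ := 1 - 1 / (4 * (k : ℝ) ^ 2 + 1)) (sub_lt_self _ (by positivity))
  have hck : 4 * (k : ℝ) ^ 2 * (1 - c) ≤ 1 := by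
    have h1 : 1 - c ≤ 1 / (4 * (k : ℝ) ^ 2 + 1) := by linarith
    rw [le_div_iff₀ (by positivity)] at h1
    linarith
  set Z : ℝ := ∫ t in (0 : ℝ)..(2 * Real.pi), cosBump c t with hZ
  have hZ0 : 0 < Z := integral_cosBump_pos hc1
  set w : ℤ → ℂ := fun m => a m * cosBumpCoeff c m with hw
  have hws : Summable fun m => ‖w m‖ := ha.summable_norm_mul_cosBumpCoeff c
  have hwle : ∀ m, ‖w m‖ ≤ Z * ‖a m‖ := by
    intro m
    rw [hw, norm_mul, mul_comm]
    gcongr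
    exact norm_cosBumpCoeff_le c m
  set h : ℝ → ℂ := fun t => G (Complex.exp (Complex.I * t)) with hh
  have hhtsum : ∀ t, h t = ∑' n : ℕ, taylorCoeff G n * circleChar n t := by
    intro t
    have := eq_tsum_taylorCoeff_circleChar hGd zero_le_one hR1 t
    simpa using this
  have hcs : Summable fun n => ‖taylorCoeff G n‖ := by
    simpa using summable_norm_taylorCoeff hGd zero_le_one hR1
  have hhc : Continuous h := by
    rw [funext hhtsum]
    exact continuous_tsum_circleChar hcs _
  have hgc : Continuous fun t => circleChar (-k) t * h t := (continuous_circleChar _).mul hhc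
  have hmul : ∀ (m : ℤ) (t : ℝ), circleChar m t * (circleChar (-k) t * h t) =
      circleChar (m - k) t * h t := by
    intro m t
    rw [← mul_assoc, ← circleChar_add, sub_eq_add_neg]
  have hsplit := integral_eq_sum_of_eq_zero
    (F := fun t => (∑' m, w m * circleChar m t) * (circleChar (-k) t * h t))
    ((continuous_tsum_circleChar hws id).mul hgc) (by linarith) hJ hdisj
    (fun x hx hxU => by
      have := hsupp.tsum_cosBumpCoeff_eq_zero (hc x ⟨hx, hxU⟩)
      simp only [hw]
      rw [this, zero_mul])
  set S := ∫ t in x₀..(x₀ + 2 * Real.pi),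
    (∑' m, w m * circleChar m t) * (circleChar (-k) t * h t) with hS
  set D : ℝ := p.factorial * 32 ^ p * 4 ^ P * Real.exp 1 with hD
  set A₂ : ℝ := ∑' m : ℤ, ‖a m‖ * (1 + |((m - k : ℤ) : ℝ)| ^ p)⁻¹ with hA₂
  have hA₂0 : 0 ≤ A₂ := tsum_nonneg fun m => by positivity
  have hSle : ‖S‖ ≤ Z * (2 * D * A₂ * ε) := by
    have hl : ∀ l ∈ J, ‖∫ t in l.1..l.2, (∑' m, w m * circleChar m t) *
        (circleChar (-k) t * h t)‖ ≤ Z * (2 * D * A₂) * (l.2 - l.1) := by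
      intro l hl
      have h1 := hasSum_mul_integral_circleChar hws id hgc l.1 l.2
      simp only [id, hmul] at h1
      have h2 : ∀ m : ℤ, ‖w m * ∫ t in l.1..l.2, circleChar (m - k) t * h t‖ ≤
          Z * (2 * D) * (l.2 - l.1) * (‖a m‖ * (1 + |((m - k : ℤ) : ℝ)| ^ p)⁻¹) := by
        intro m
        have h3 := norm_integral_circleChar_mul_vanishProd_le
          (fun l hl => ⟨(hJ l hl).1, (hJ l hl).2.1, (hJ l hl).2.2, hle1 l hl⟩) hdisj hθ0 hθ1 hη4
          hPη hpP hl (m - k)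
        have h4 : (0 : ℝ) < 1 + |((m - k : ℤ) : ℝ)| ^ p := by positivity
        rw [mul_comm, ← le_div_iff₀ h4] at h3
        calc _ ≤ Z * ‖a m‖ * (2 * D * (l.2 - l.1) / (1 + |((m - k : ℤ) : ℝ)| ^ p)) := by
              rw [norm_mul]
              exact mul_le_mul (hwle m) h3 (norm_nonneg _) (by positivity)
          _ = _ := by rw [div_eq_mul_inv]; ring
      have h5 := h1.norm_le_of_bounded (hp.mul_left (Z * (2 * D) * (l.2 - l.1))).hasSum h2
      rw [tsum_mul_left] at h5
      refine h5.trans_eq ?_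
      ring
    have hδε : ∑ l ∈ J, (l.2 - l.1) ≤ ε := by
      refine (Finset.sum_le_sum fun l hl => ?_).trans hJε.le
      simpa using Real.rpow_le_rpow_of_exponent_ge (hpos l hl) (hle1 l hl) (hbβ.trans hβ1).le
    have hD0 : 0 ≤ D := by positivity
    rw [hsplit]
    calc _ ≤ ∑ l ∈ J, Z * (2 * D * A₂) * (l.2 - l.1) := norm_sum_le_of_le _ hl
      _ = Z * (2 * D * A₂) * ∑ l ∈ J, (l.2 - l.1) := by rw [Finset.mul_sum]
      _ ≤ Z * (2 * D * A₂) * ε := by gcongr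
      _ = _ := by ring
  have hseries : HasSum (fun j : ℕ => w (k - j) * (2 * Real.pi * taylorCoeff G j)) S := by
    have h1 := hasSum_mul_integral_circleChar hws id hgc x₀ (x₀ + 2 * Real.pi)
    simp only [id, hmul] at h1
    have h2 : ∀ m : ℤ, ∫ t in x₀..(x₀ + 2 * Real.pi), circleChar (m - k) t * h t =
        if m - k ≤ 0 then 2 * Real.pi * taylorCoeff G (-(m - k)).toNat else 0 := by
      intro m
      simp_rw [hhtsum]
      exact integral_circleChar_mul_tsum hcs x₀ (m - k)
    simp_rw [h2] at h1
    have hinj : Function.Injective fun j : ℕ => k - (j : ℤ) := fun i j hij => by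
      simp only at hij; omega
    rw [← hinj.hasSum_iff] at h1
    · refine h1.congr_fun ?_
      intro j
      simp only [Function.comp]
      rw [if_pos (by omega)]
      congr 4
      omega
    · intro m hm
      rw [if_neg, mul_zero]
      intro hmk
      exact hm ⟨(k - m).toNat, by simp only; omega⟩
  set A₁ : ℝ := ∑' j : ℕ, ‖a (k - (j + 1 : ℕ))‖ ^ 2 / ((j + 1 : ℕ) : ℝ) ^ (1 - α) with hA₁
  have htail : ∀ T : Finset ℕ, ∑ j ∈ T,
      ‖w (k - ((j + 1 : ℕ) : ℤ)) * (2 * Real.pi * taylorCoeff G (j + 1))‖ ≤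
      Z * (2 * Real.pi * (√A₁ * √(C * (4 * Real.pi * P * ε)))) := by
    intro T
    have hroot : ∀ j : ℕ, (0 : ℝ) < √(((j + 1 : ℕ) : ℝ) ^ (1 - α)) := fun j =>
      Real.sqrt_pos.mpr (by positivity)
    have hrootsq : ∀ j : ℕ, √(((j + 1 : ℕ) : ℝ) ^ (1 - α)) ^ 2 = ((j + 1 : ℕ) : ℝ) ^ (1 - α) :=
      fun j => Real.sq_sqrt (by positivity)
    calc _ ≤ ∑ j ∈ T, Z * (2 * Real.pi) *
          ((‖a (k - (j + 1 : ℕ))‖ / √(((j + 1 : ℕ) : ℝ) ^ (1 - α))) *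
            (√(((j + 1 : ℕ) : ℝ) ^ (1 - α)) * ‖taylorCoeff G (j + 1)‖)) := by
          refine Finset.sum_le_sum fun j _ => ?_
          have h1 : (‖a (k - (j + 1 : ℕ))‖ / √(((j + 1 : ℕ) : ℝ) ^ (1 - α))) *
              (√(((j + 1 : ℕ) : ℝ) ^ (1 - α)) * ‖taylorCoeff G (j + 1)‖) =
              ‖a (k - (j + 1 : ℕ))‖ * ‖taylorCoeff G (j + 1)‖ := by
            rw [← mul_assoc, div_mul_cancel₀ _ (hroot j).ne']
          have h2 : ‖(2 * Real.pi : ℂ)‖ = 2 * Real.pi := by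
            rw [norm_mul, Complex.norm_ofNat, norm_real, Real.norm_of_nonneg hpi.le]
          rw [h1, norm_mul (w _), norm_mul (2 * Real.pi : ℂ), h2]
          calc _ ≤ Z * ‖a (k - (j + 1 : ℕ))‖ * (2 * Real.pi * ‖taylorCoeff G (j + 1)‖) := by
                gcongr
                exact hwle _
            _ = _ := by ring
      _ = Z * (2 * Real.pi) * ∑ j ∈ T, (‖a (k - (j + 1 : ℕ))‖ / √(((j + 1 : ℕ) : ℝ) ^ (1 - α))) *
            (√(((j + 1 : ℕ) : ℝ) ^ (1 - α)) * ‖taylorCoeff G (j + 1)‖) := by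
          rw [Finset.mul_sum]
      _ ≤ Z * (2 * Real.pi) * (√A₁ * √(C * (4 * Real.pi * P * ε))) := by
          refine mul_le_mul_of_nonneg_left ((Real.sum_mul_le_sqrt_mul_sqrt _ _ _).trans ?_)
            (by positivity)
          simp_rw [div_pow, mul_pow, hrootsq]
          exact mul_le_mul (Real.sqrt_le_sqrt (hsum.sum_le_tsum T fun j _ => by positivity))
            (Real.sqrt_le_sqrt (hsq T)) (Real.sqrt_nonneg _) (Real.sqrt_nonneg _)
      _ = _ := by ring
  have hfin := norm_sub_le_of_hasSum hseries htail
  have hk : Z * (‖a k‖ * (Real.pi / 2)) ≤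
      ‖w (k - ((0 : ℕ) : ℤ)) * (2 * Real.pi * taylorCoeff G 0)‖ := by
    have h1 : 1 / 2 ≤ ‖taylorCoeff G 0‖ := by
      have : taylorCoeff G 0 = G 0 := by simp [taylorCoeff]
      rw [this]
      exact half_le_norm_vanishProd_zero hη hPη
    have h2 := le_norm_cosBumpCoeff k hck
    rw [Nat.cast_zero, sub_zero, hw, norm_mul, norm_mul, norm_mul, norm_mul, Complex.norm_ofNat,
      norm_real, Real.norm_of_nonneg hpi.le]
    calc Z * (‖a k‖ * (Real.pi / 2)) = ‖a k‖ * (Z / 2) * (2 * Real.pi * (1 / 2)) := by ring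
      _ ≤ _ := by gcongr
  refine le_of_mul_le_mul_left ?_ hZ0
  rw [mul_add]
  exact (hk.trans hfin).trans (add_le_add hSle le_rfl)

/-- One-sided Frostman–Beurling theorem (Kozma–Olevskii): if a compact set `K` in the
circle supports a nonzero distribution `S` with `∑_{n<0} |Ŝ(n)|² / |n|^{1-a} < ∞` for
some `0 < a ≤ 1`, then the Hausdorff dimension of `K` is at least `a`. -/
theorem one_sided_frostman (a : ℤ → ℂ) (ha : HasPolyGrowth a) (hne : a ≠ 0)
    (K : Set ℝ) (hK : IsCompact K) (hsupp : DistribSupportedIn a K)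
    (α : ℝ) (hα0 : 0 < α) (hα1 : α ≤ 1)
    (hsum : Summable fun n : ℕ => ‖a (-(n + 1 : ℕ))‖ ^ 2 / ((n + 1 : ℝ)) ^ (1 - α)) :
    ENNReal.ofReal α ≤ dimH K := by
  by_contra! hdim
  obtain ⟨b, hb, hbα⟩ := ENNReal.lt_iff_exists_nnreal_btwn.mp hdim
  rw [ENNReal.coe_lt_ofReal] at hbα
  have hb0 : (0 : ℝ) < b := by
    have : (0 : ENNReal) < b := bot_le.trans_lt hb
    exact_mod_cast this
  obtain ⟨β, hbβ, hβα⟩ := exists_between hbα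
  have hβ0 : 0 < β := hb0.trans hbβ
  have hdim' : dimH (periodization K) < b := (dimH_periodization_le K).trans_lt hb
  have hμ : Measure.hausdorffMeasure (b : ℝ) (periodization K) = 0 :=
    hausdorffMeasure_of_dimH_lt hdim'
  obtain ⟨x₀, hx₀⟩ : ∃ x₀, x₀ ∉ periodization K := by
    have : Dense (periodization K)ᶜ := dense_compl_of_dimH_lt_finrank (by
      refine hdim'.trans ?_
      rw [Module.finrank_self]
      exact_mod_cast (hbα.trans_le hα1))
    exact this.nonempty
  set K' := periodization K ∩ Set.Icc x₀ (x₀ + 2 * Real.pi) with hK'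
  have hK'c : IsCompact K' := isCompact_Icc.inter_left (isClosed_periodization hK)
  have hK'I : K' ⊆ Set.Ioo x₀ (x₀ + 2 * Real.pi) := by
    rintro x ⟨hxK, hx1, hx2⟩
    refine ⟨lt_of_le_of_ne hx1 ?_, lt_of_le_of_ne hx2 ?_⟩
    · rintro rfl; exact hx₀ hxK
    · rintro rfl; exact hx₀ (add_two_pi_mem_periodization.mp hxK)
  have hμ' : Measure.hausdorffMeasure (b : ℝ) K' = 0 :=
    measure_mono_null Set.inter_subset_left hμ
  obtain ⟨p, hp⟩ := ha.exists_summable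
  have hθ1 : (b : ℝ) / β < 1 := (div_lt_one hβ0).mpr hbβ
  obtain ⟨P, hP⟩ := exists_nat_ge ((2 * p + 1 : ℝ) / (1 - b / β))
  rw [div_le_iff₀' (by linarith)] at hP
  obtain ⟨C, hC0, hC⟩ := sum_rpow_mul_sq_taylorCoeff_le hβ0 hβα
  refine hne (funext fun k => ?_)
  have hev : ∀ᶠ ε : ℝ in nhdsWithin 0 (Set.Ioi 0), ‖a k‖ * (Real.pi / 2) ≤
      2 * (p.factorial * 32 ^ p * 4 ^ P * Real.exp 1) *
        (∑' m : ℤ, ‖a m‖ * (1 + |((m - k : ℤ) : ℝ)| ^ p)⁻¹) * ε +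
      2 * Real.pi * (√(∑' j : ℕ, ‖a (k - (j + 1 : ℕ))‖ ^ 2 / ((j + 1 : ℕ) : ℝ) ^ (1 - α)) *
        √(C * (4 * Real.pi * P * ε))) := by
    have h1 : (0 : ℝ) < 1 / (8 * (P + 1)) := by positivity
    filter_upwards [Ioo_mem_nhdsGT h1] with ε hε
    obtain ⟨J, hJ1, hJ2, hJ3, hJ4⟩ := exists_disjoint_interval_cover hK'c hK'I hb0
      (hbα.trans_le hα1).le hμ' hε.1
    have h2 := hε.2.le
    rw [le_div_iff₀' (by positivity)] at h2
    exact norm_le_of_cover ha hK hsupp (summable_sq_shift hα1 hsum k) (hp k) hb0 hbβ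
      (hβα.trans_le hα1) hP hC0 hC hε.1 h2 hJ1 hJ4 hJ2 hJ3
  have hlim := ge_of_tendsto (Tendsto.mono_left (Continuous.tendsto (by fun_prop) 0)
    nhdsWithin_le_nhds) hev
  simp only [mul_zero, Real.sqrt_zero, add_zero] at hlim
  have : ‖a k‖ ≤ 0 := by nlinarith [Real.pi_pos, norm_nonneg (a k)]
  exact norm_le_zero_iff.mp this
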